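/- arXiv:0904.3110 — 3 statements merged into one kernel-verified Lean document; each statement's English description precedes it below -/
import Mathlib

section
/- For each d ∈ {7, 8, 9, 10, 12} there exists a lattice Λ in ℝ⁹ possessing a Minkowskian sublattice Λ' such that Λ/Λ' is cyclic of order d; none of these cyclic quotient orders occurs for any lattice of dimension at most 8. -/
open scoped BigOperators RealInnerProductSpace

noncomputable section

/-- The minimum of a lattice `Λ` in `ℝⁿ`: the infimum of the squared Euclidean
lengths `N(x) = ⟪x, x⟫` of the nonzero vectors of `Λ`. -/
def latticeMin {n : ℕ} (Λ : Submodule ℤ (EuclideanSpace ℝ (Fin n))) : ℝ :=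
  sInf {r : ℝ | ∃ x ∈ Λ, x ≠ 0 ∧ ⟪x, x⟫ = r}

/-- The set of minimal vectors of a lattice `Λ`:
`S(Λ) = {x ∈ Λ : x ≠ 0, N(x) = min Λ}`. -/
def minimalVectors {n : ℕ} (Λ : Submodule ℤ (EuclideanSpace ℝ (Fin n))) :
    Set (EuclideanSpace ℝ (Fin n)) :=
  {x | x ∈ Λ ∧ x ≠ 0 ∧ ⟪x, x⟫ = latticeMin Λ}

/-- `Λ` is a (full-rank) lattice in `ℝⁿ`: a discrete subgroup that spans `ℝⁿ`. -/
def IsLattice {n : ℕ} (Λ : Submodule ℤ (EuclideanSpace ℝ (Fin n))) : Prop :=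
  DiscreteTopology Λ ∧ Submodule.span ℝ (Λ : Set (EuclideanSpace ℝ (Fin n))) = ⊤

/-- `Λ'` is a Minkowskian sublattice of `Λ`: it is generated by `n` linearly
independent minimal vectors of `Λ`. -/
def IsMinkowskian {n : ℕ} (Λ Λ' : Submodule ℤ (EuclideanSpace ℝ (Fin n))) : Prop :=
  ∃ e : Fin n → EuclideanSpace ℝ (Fin n),
    LinearIndependent ℝ e ∧ (∀ i, e i ∈ minimalVectors Λ) ∧
      Λ' = Submodule.span ℤ (Set.range e)

/-- The quotient group `Λ/Λ'`. -/
abbrev quotLat {n : ℕ} (Λ Λ' : Submodule ℤ (EuclideanSpace ℝ (Fin n))) : Type :=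
  Λ ⧸ (Submodule.comap Λ.subtype Λ')

/-- The index `[Λ : Λ']`. -/
def subIndex {n : ℕ} (Λ Λ' : Submodule ℤ (EuclideanSpace ℝ (Fin n))) : ℕ :=
  Nat.card (quotLat Λ Λ')

/-- The least absolute value in the residue class of `x` modulo `d`. -/
def redAbs (d x : ℕ) : ℕ := min (x % d) (d - x % d)

/-- The representative of `x` modulo `d` of least absolute value or, if `flip` holds, the
representative of opposite sign in `[-d, d]`. -/
def rounding (d x : ℕ) (flip : Bool) : ℤ :=
  if xor (decide (2 * (x % d) ≤ d)) flip then ((x % d : ℕ) : ℤ) else ((x % d : ℕ) : ℤ) - d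

/-- The triple `(c, t, F)` encodes, with weight `c`, the rounding of the multiple `t • w` of the
word `w` modulo `d`, with the coordinates in `F` flipped. -/
def termVec (d : ℕ) (w : List ℕ) (p : ℕ × ℕ × List ℕ) (i : Fin w.length) : ℤ :=
  rounding d (p.2.1 * w.get i) (p.2.2.contains i)

/-- A weighted list of vectors congruent to multiples of `w` modulo `d`, whose second moment matrix
is diagonal with trace less than `d ^ 2` times the total weight. -/
def IsCertificate (d : ℕ) (w : List ℕ) (c : List (ℕ × ℕ × List ℕ)) : Prop :=
  (∀ p ∈ c, ∃ i, termVec d w p i ≠ 0) ∧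
  (∀ i j, i ≠ j → (c.map fun p => (p.1 : ℤ) * (termVec d w p i * termVec d w p j)).sum = 0) ∧
  (c.map fun p => (p.1 : ℤ) * ∑ i, termVec d w p i ^ 2).sum < (c.map fun p => (p.1 : ℤ) * d ^ 2).sum

instance decidableIsCertificate (d : ℕ) (w : List ℕ) (c : List (ℕ × ℕ × List ℕ)) :
    Decidable (IsCertificate d w c) := by
  unfold IsCertificate; infer_instance

/-- Words modulo `d` of length at most `8`, each with a certificate that it cannot define a lattice
containing a frame of minimal vectors. -/
def certificates : ℕ → List (List ℕ × List (ℕ × ℕ × List ℕ))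
  | 7 => [
    ([1, 1, 1, 2, 2, 2, 3, 3],
      [(1, 1, []), (1, 1, [6]), (1, 1, [7]), (1, 2, [3]), (1, 2, [4]), (1, 2, [5]),
       (1, 3, [0]), (1, 3, [1]), (1, 3, [2])]),
    ([1, 1, 1, 1, 2, 3, 3, 3],
      [(1, 1, []), (1, 1, [5]), (1, 1, [6]), (1, 1, [7]), (2, 2, []), (1, 2, [0, 4]),
       (1, 2, [1, 4]), (1, 2, [2, 4]), (1, 2, [3, 4])]),
    ([1, 1, 1, 1, 2, 2, 3, 3],
      [(6, 1, []), (2, 1, [4]), (2, 1, [5]), (6, 1, [6]), (6, 1, [7]), (1, 1, [6, 7]),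
       (6, 2, []), (1, 2, [0, 4]), (1, 2, [0, 5]), (1, 2, [1, 4]), (1, 2, [1, 5]),
       (1, 2, [2, 4]), (1, 2, [2, 5]), (1, 2, [3, 4]), (1, 2, [3, 5]), (1, 3, [0, 1]),
       (1, 3, [0, 2]), (1, 3, [0, 3]), (1, 3, [1, 2]), (1, 3, [1, 3]), (1, 3, [2, 3])])]
  | 8 => [
    ([1, 1, 2, 2, 3, 3, 4, 4],
      [(1, 2, []), (1, 2, [2]), (1, 2, [3]), (1, 2, [2, 3]), (1, 4, []), (1, 4, [0, 4]),
       (1, 4, [1, 4])]),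
    ([1, 1, 2, 2, 2, 3, 3, 4],
      [(1, 1, []), (1, 1, [7]), (1, 2, [2]), (1, 2, [3]), (1, 2, [4]), (1, 3, []),
       (1, 3, [7]), (1, 4, [0, 5]), (1, 4, [1, 5])]),
    ([1, 1, 2, 2, 2, 2, 3, 3],
      [(1, 1, []), (1, 1, [2]), (1, 1, [3]), (1, 1, [4]), (1, 1, [5]), (1, 1, [6]),
       (1, 1, [7]), (1, 3, []), (1, 4, [0, 1]), (1, 4, [0, 6]), (1, 4, [1, 6])]),
    ([1, 1, 1, 2, 3, 3, 3, 4],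
      [(1, 1, []), (1, 1, [4, 7]), (1, 1, [5, 7]), (1, 1, [6, 7]), (1, 2, []), (1, 2, [3]),
       (1, 3, []), (1, 3, [0, 7]), (1, 3, [1, 7]), (1, 3, [2, 7])]),
    ([1, 1, 1, 2, 2, 3, 4, 4],
      [(1, 2, []), (1, 2, [3]), (1, 2, [4]), (1, 2, [3, 4]), (1, 4, [0]), (1, 4, [1]),
       (1, 4, [2])]),
    ([1, 1, 1, 2, 2, 3, 3, 4],
      [(1, 1, []), (1, 1, [7]), (1, 1, [5, 7]), (1, 1, [6, 7]), (1, 2, [3]), (1, 2, [4]),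
       (1, 3, []), (1, 3, [0, 7]), (1, 3, [1, 7]), (1, 3, [2, 7])]),
    ([1, 1, 1, 2, 2, 3, 3, 3],
      [(1, 1, []), (1, 1, [5]), (1, 1, [6]), (1, 1, [7]), (1, 2, [3]), (1, 2, [4]),
       (1, 3, []), (1, 3, [0]), (1, 3, [1]), (1, 3, [2])]),
    ([1, 1, 1, 2, 2, 2, 3, 4],
      [(1, 1, []), (1, 1, [6]), (1, 1, [7]), (1, 1, [6, 7]), (1, 2, [3, 4]), (1, 2, [3, 5]),
       (1, 2, [4, 5]), (1, 4, [0]), (1, 4, [1]), (1, 4, [2])]),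
    ([1, 1, 1, 1, 3, 3, 3, 3],
      [(1, 1, [4]), (1, 1, [5]), (1, 1, [6]), (1, 1, [7]), (2, 2, []), (1, 3, [0]),
       (1, 3, [1]), (1, 3, [2]), (1, 3, [3])]),
    ([1, 1, 1, 1, 2, 3, 3, 4],
      [(2, 1, []), (1, 1, [5]), (1, 1, [6]), (2, 1, [7]), (1, 1, [5, 7]), (1, 1, [6, 7]),
       (1, 2, [0]), (1, 2, [1]), (1, 2, [2]), (1, 2, [3]), (2, 2, [4])]),
    ([1, 1, 1, 1, 2, 2, 4, 4],
      [(1, 1, []), (1, 1, [6]), (1, 1, [7]), (1, 1, [6, 7]), (1, 2, [4]), (1, 2, [5]),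
       (1, 2, [4, 5]), (1, 4, [0, 1]), (1, 4, [0, 2]), (1, 4, [1, 2])]),
    ([1, 1, 2, 2, 3, 3, 4],
      [(1, 1, []), (1, 1, [6]), (1, 2, []), (1, 2, [2]), (1, 2, [3]), (1, 3, []),
       (1, 3, [6]), (1, 4, [0, 4]), (1, 4, [1, 4])])]
  | 9 => [
    ([1, 1, 2, 2, 3, 3, 4, 4],
      [(1, 1, []), (1, 1, [6]), (1, 1, [7]), (1, 2, []), (1, 2, [2, 5]), (1, 2, [3, 5]),
       (1, 3, []), (1, 4, [0]), (1, 4, [1]), (1, 4, [5])]),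
    ([1, 1, 1, 2, 3, 3, 4, 4],
      [(1, 1, []), (1, 1, [4]), (1, 1, [5]), (2, 1, [6]), (2, 1, [7]), (2, 2, []),
       (1, 2, [3]), (1, 2, [3, 4]), (1, 2, [3, 5]), (1, 3, [0]), (1, 3, [1]), (1, 3, [2])]),
    ([1, 1, 1, 2, 2, 3, 4, 4],
      [(1, 1, []), (1, 1, [6]), (1, 1, [7]), (1, 2, []), (1, 2, [3]), (1, 2, [4]),
       (1, 3, []), (1, 4, [0]), (1, 4, [1]), (1, 4, [2])])]
  | 10 => [
    ([1, 1, 2, 2, 3, 4, 4, 5],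
      [(1, 2, []), (1, 2, [2]), (1, 2, [3]), (1, 2, [4]), (1, 4, [0]), (1, 4, [1]),
       (1, 4, [5]), (1, 4, [6])]),
    ([1, 1, 2, 2, 3, 3, 4, 5],
      [(1, 2, [2]), (1, 2, [3]), (1, 2, [4]), (1, 2, [5]), (1, 4, []), (1, 4, [0]),
       (1, 4, [1]), (1, 4, [6])]),
    ([1, 1, 2, 2, 3, 3, 4, 4],
      [(1, 1, []), (1, 1, [6]), (1, 1, [7]), (1, 2, []), (1, 3, []), (1, 3, [2]),
       (1, 3, [3]), (1, 4, []), (1, 5, [0, 4]), (1, 5, [1, 4])]),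
    ([1, 1, 2, 2, 2, 3, 4, 5],
      [(1, 1, []), (1, 1, [6]), (1, 1, [7]), (1, 1, [6, 7]), (1, 2, [2]), (1, 2, [3]),
       (1, 2, [4]), (1, 4, []), (1, 4, [0]), (1, 4, [1]), (1, 4, [6])]),
    ([1, 1, 1, 2, 3, 4, 4, 4],
      [(1, 1, []), (1, 1, [4]), (2, 1, [5]), (2, 1, [6]), (2, 1, [7]), (2, 2, []),
       (1, 2, [3]), (1, 2, [3, 4]), (1, 3, []), (1, 3, [0]), (1, 3, [1]), (1, 3, [2])]),
    ([1, 1, 1, 2, 3, 3, 4, 5],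
      [(1, 1, []), (1, 1, [7]), (1, 2, []), (1, 2, [4]), (1, 2, [5]), (1, 3, []),
       (1, 3, [7]), (1, 4, [0]), (1, 4, [1]), (1, 4, [2])])]
  | 12 => [
    ([1, 2, 2, 3, 3, 4, 4, 5],
      [(2, 1, []), (1, 1, [5]), (1, 1, [6]), (1, 1, [7]), (1, 2, [3]), (1, 2, [4]),
       (1, 3, []), (2, 3, [1]), (2, 3, [2]), (1, 3, [1, 2]), (2, 5, []), (1, 5, [0]),
       (1, 5, [5]), (1, 5, [6]), (1, 6, [0, 3]), (1, 6, [0, 4])]),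
    ([1, 1, 2, 3, 4, 4, 5, 6],
      [(1, 2, []), (1, 2, [2]), (1, 2, [3]), (1, 2, [4]), (1, 2, [5]), (1, 3, []),
       (1, 3, [2]), (1, 3, [7]), (1, 3, [2, 7]), (1, 4, []), (1, 6, [0]), (1, 6, [1])]),
    ([1, 1, 2, 3, 3, 4, 5, 5],
      [(1, 1, []), (1, 1, [6]), (1, 1, [7]), (1, 2, [3]), (1, 2, [4]), (1, 3, []),
       (1, 3, [2]), (1, 4, []), (1, 5, []), (1, 5, [0]), (1, 5, [1])]),
    ([1, 1, 2, 2, 4, 4, 5, 5],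
      [(1, 1, []), (1, 2, []), (1, 2, [4]), (1, 2, [5]), (1, 3, [2]), (1, 3, [3]),
       (1, 4, []), (1, 5, []), (1, 6, [0, 6]), (1, 6, [1, 6])]),
    ([1, 1, 2, 2, 3, 4, 5, 6],
      [(1, 1, []), (1, 1, [6]), (1, 1, [7]), (1, 2, []), (1, 2, [4]), (1, 3, [2]),
       (1, 3, [3]), (1, 4, []), (1, 5, [0]), (1, 5, [1]), (1, 5, [7])]),
    ([1, 1, 1, 3, 3, 5, 5, 5],
      [(1, 1, [5]), (1, 1, [6]), (1, 1, [7]), (1, 2, []), (2, 2, [3]), (2, 2, [4]),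
       (1, 2, [3, 4]), (2, 3, []), (1, 5, [0]), (1, 5, [1]), (1, 5, [2])])]
  | _ => []
theorem isCertificate_of_mem_certificates : ∀ d ∈ [7, 8, 9, 10, 12], ∀ p ∈ certificates d,
    (∀ a ∈ p.1, a ≠ 0 ∧ 2 * a ≤ d) ∧ IsCertificate d p.1 p.2 := by
  decide +kernel

/-- The sum of `g` over a family of natural numbers in which `k + j` occurs `l[j]` times. -/
def weightedSum (g : ℕ → ℕ) : ℕ → List ℕ → ℕ
  | _, [] => 0
  | k, a :: l => a * g k + weightedSum g (k + 1) l

theorem weightedSum_map_range' (g m : ℕ → ℕ) (k n : ℕ) :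
    weightedSum g k ((List.range' k n).map m) = ∑ j ∈ Finset.Ico k (k + n), m j * g j := by
  induction n generalizing k with
  | zero => simp [weightedSum]
  | succ n ih =>
    rw [List.range'_succ, List.map_cons, weightedSum, ih,
      Finset.sum_eq_sum_Ico_succ_bot (by omega : k < k + (n + 1)),
      show k + 1 + n = k + (n + 1) by ring]

/-- Test a predicate on all lists of `k` natural numbers with sum at most `n`. -/
def forallComposition : ℕ → ℕ → (List ℕ → Bool) → Bool
  | 0, _, p => p []
  | k + 1, n, p =>
    (List.range (n + 1)).all fun i => forallComposition k (n - i) fun l => p (i :: l)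

theorem forallComposition_apply {k n : ℕ} {p : List ℕ → Bool}
    (h : forallComposition k n p = true) {l : List ℕ} (hk : l.length = k) (hl : l.sum ≤ n) :
    p l = true := by
  subst hk
  induction l generalizing n p with
  | nil => exact h
  | cons a l ih =>
    simp only [List.sum_cons] at hl
    simp only [List.length_cons, forallComposition, List.all_eq_true, List.mem_range] at h
    exact ih (Nat.le_sub_of_add_le' hl) (h a (by omega))

/-- Let `x` list the multiplicities of the absolute residues `1, 2, …, d / 2` in a word modulo `d`
of length at most `8`. If all nonzero multiples of the word have weight at least `2 * d`, then some
multiple of it is a word in `certificates d`. -/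
theorem exists_mem_certificates {d : ℕ} (hd : d ∈ [7, 8, 9, 10, 12]) {x : List ℕ}
    (hlen : x.length = d / 2) (hsum : x.sum ≤ 8)
    (hx : ∀ t < d, t ≠ 0 → 2 * d ≤ weightedSum (fun k => redAbs d (t * k)) 1 x) :
    ∃ t < d, ∃ p ∈ certificates d, ∀ k < d / 2 + 1, k ≠ 0 →
      p.1.count k = weightedSum (fun j => if redAbs d (t * j) = k then 1 else 0) 1 x := by
  have key : ∀ d ∈ [7, 8, 9, 10, 12], forallComposition (d / 2) 8 (fun x => decide (
      (∀ t < d, t ≠ 0 → 2 * d ≤ weightedSum (fun k => redAbs d (t * k)) 1 x) →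
      ∃ t < d, ∃ p ∈ certificates d, ∀ k < d / 2 + 1, k ≠ 0 →
        p.1.count k = weightedSum (fun j => if redAbs d (t * j) = k then 1 else 0) 1 x)) =
      true := by
    decide +kernel
  exact of_decide_eq_true (forallComposition_apply (key d hd) hlen hsum) hx

section Frame

variable {E : Type*} [NormedAddCommGroup E] [InnerProductSpace ℝ E] {ι κ : Type*} [Fintype ι]
  [Fintype κ]

/-- The vectors `e i` have norm `m`, and no nonzero vector of the lattice generated by them and
`(1 / d) • ∑ i, a i • e i` has smaller norm. -/
structure IsMinimalFrame (d : ℕ) (m : ℝ) (e : ι → E) (a : ι → ℤ) : Prop where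
  inner_self : ∀ i, ⟪e i, e i⟫ = m
  le_inner : ∀ z : ι → ℤ, z ≠ 0 → ∀ t : ℤ, (∀ i, (d : ℤ) ∣ z i - t * a i) →
    d ^ 2 * m ≤ ⟪∑ i, z i • e i, ∑ i, z i • e i⟫

namespace IsMinimalFrame

variable {d : ℕ} {m : ℝ} {e : ι → E} {a : ι → ℤ}

/-- The word may be multiplied by `s`, changed modulo `d`, and changed in signs. -/
theorem exists_signs (h : IsMinimalFrame d m e a) (s : ℤ) {b : ι → ℤ}
    (hb : ∀ i, (d : ℤ) ∣ s * a i - b i ∨ (d : ℤ) ∣ s * a i + b i) :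
    ∃ e' : ι → E, IsMinimalFrame d m e' b := by
  have : ∀ i, ∃ u : ℤ, u * u = 1 ∧ (d : ℤ) ∣ s * a i - u * b i := fun i => by
    rcases hb i with h | h
    · exact ⟨1, by norm_num, by simpa using h⟩
    · exact ⟨-1, by norm_num, by simpa using h⟩
  choose u hu hub using this
  refine ⟨fun i => u i • e i, fun i => ?_, fun z hz t ht => ?_⟩
  · have : (u i : ℝ) * u i = 1 := by exact_mod_cast hu i
    rw [← Int.cast_smul_eq_zsmul ℝ, inner_smul_left, inner_smul_right, h.inner_self]
    simp [← mul_assoc, this]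
  · simp only [smul_smul]
    refine h.le_inner (fun i => z i * u i) (fun h0 => hz (funext fun i => ?_)) (t * s) fun i => ?_
    · have := congrFun h0 i
      simp only [Pi.zero_apply] at this ⊢
      linear_combination u i * this - z i * hu i
    · have h1 : z i * u i - t * s * a i
          = u i * (z i - t * b i) - t * (s * a i - u i * b i) := by ring
      rw [h1]
      exact dvd_sub ((ht i).mul_left _) ((hub i).mul_left _)

theorem comp_injective (h : IsMinimalFrame d m e a) {f : κ → ι} (hf : f.Injective)
    (ha : ∀ i ∉ Set.range f, a i = 0) : IsMinimalFrame d m (e ∘ f) (a ∘ f) where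
  inner_self i := h.inner_self _
  le_inner z hz t ht := by
    have hsum : ∑ i, z i • (e ∘ f) i = ∑ i, Function.extend f z 0 i • e i := by
      rw [← Finset.sum_subset (Finset.subset_univ (Finset.univ.map ⟨f, hf⟩)), Finset.sum_map]
      · exact Finset.sum_congr rfl fun i _ => by simp [hf.extend_apply]
      · intro i _ hi
        rw [Function.extend_apply', Pi.zero_apply, zero_smul]
        simpa using hi
    rw [hsum]
    refine h.le_inner _ (fun h0 => hz (funext fun i => ?_)) t fun i => ?_
    · simpa [hf.extend_apply] using congrFun h0 (f i)
    · by_cases hi : ∃ j, f j = i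
      · obtain ⟨j, rfl⟩ := hi
        simpa [hf.extend_apply] using ht j
      · rw [Function.extend_apply' _ _ _ hi, ha i (by simpa using hi)]
        simp

/-- Watson's condition. -/
theorem two_mul_le_sum (hm : 0 < m) {w : ι → ℕ} (h : IsMinimalFrame d m e fun i => w i)
    (hw : ∀ i, w i < d) {i₀ : ι} (h₀ : w i₀ ≠ 0) : 2 * d ≤ ∑ i, w i := by
  classical
  set W : E := ∑ i, (w i : ℤ) • e i with hW
  have hd : (0 : ℝ) < d := by exact_mod_cast (Nat.zero_le _).trans_lt (hw i₀)
  have hWpos : 0 < ⟪W, W⟫ := by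
    refine lt_of_lt_of_le (by positivity) (h.le_inner (fun i => w i) (fun h0 => h₀ ?_) 1 ?_)
    · simpa using congrFun h0 i₀
    · simp
  have hflip : ∀ i, (w i : ℝ) * (2 * d * ⟪W, e i⟫) ≤ w i * ⟪W, W⟫ := fun i => by
    rcases eq_or_ne (w i) 0 with hi | hi
    · simp [hi]
    refine mul_le_mul_of_nonneg_left ?_ (Nat.cast_nonneg _)
    have hz := h.le_inner (fun j => (w j : ℤ) - if j = i then (d : ℤ) else 0)
      (fun h0 => by have := congrFun h0 i; have := hw i; simp at *; omega) 1
      (fun j => by by_cases hj : j = i <;> simp [hj])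
    have hsum : ∑ j, ((w j : ℤ) - if j = i then (d : ℤ) else 0) • e j = W - (d : ℝ) • e i := by
      simp [sub_smul, Finset.sum_sub_distrib, hW, ite_smul, Nat.cast_smul_eq_nsmul ℝ]
    rw [hsum] at hz
    simp only [inner_sub_left, inner_sub_right, inner_smul_left, inner_smul_right,
      h.inner_self, real_inner_comm W (e i), RCLike.conj_to_real] at hz
    linarith
  have hWW : ⟪W, W⟫ = ∑ i, (w i : ℝ) * ⟪W, e i⟫ := by
    conv_lhs => rw [hW, inner_sum, ← hW]
    exact Finset.sum_congr rfl fun i _ => by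
      rw [← Int.cast_smul_eq_zsmul ℝ, inner_smul_right, Int.cast_natCast]
  have hle := Finset.sum_le_sum fun i (_ : i ∈ Finset.univ) => hflip i
  have h1 : ∑ i, (w i : ℝ) * (2 * d * ⟪W, e i⟫) = 2 * d * ⟪W, W⟫ := by
    rw [hWW, Finset.mul_sum]
    exact Finset.sum_congr rfl fun i _ => by ring
  rw [h1, ← Finset.sum_mul] at hle
  exact_mod_cast le_of_mul_le_mul_right hle hWpos

end IsMinimalFrame

theorem rounding_sub_dvd (d x : ℕ) (b : Bool) : (d : ℤ) ∣ rounding d x b - x := by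
  have h : (d : ℤ) ∣ ((x % d : ℕ) : ℤ) - x := by
    rw [Int.natCast_mod]
    exact dvd_sub_comm.mp Int.dvd_self_sub_emod
  unfold rounding
  split_ifs
  · exact h
  · rw [sub_right_comm]
    exact dvd_sub_self_right.mpr h

theorem dvd_sub_redAbs_or {d : ℕ} (hd : 0 < d) (x : ℕ) :
    (d : ℤ) ∣ x - redAbs d x ∨ (d : ℤ) ∣ x + redAbs d x := by
  have h : (d : ℤ) ∣ x - ((x % d : ℕ) : ℤ) := by
    rw [Int.natCast_mod]
    exact Int.dvd_self_sub_emod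
  have hlt := (Nat.mod_lt x hd).le
  unfold redAbs
  rcases le_total (x % d) (d - x % d) with h' | h'
  · left; rwa [min_eq_left h']
  · right
    rw [min_eq_right h', Nat.cast_sub hlt]
    have h1 : (x : ℤ) + (d - ((x % d : ℕ) : ℤ)) = (x - ((x % d : ℕ) : ℤ)) + d := by ring
    rw [h1]
    exact dvd_add h dvd_rfl

theorem IsCertificate.not_isMinimalFrame {d : ℕ} {w : List ℕ} {c : List (ℕ × ℕ × List ℕ)}
    (hc : IsCertificate d w c) {m : ℝ} (hm : 0 < m) {e : Fin w.length → E} :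
    ¬ IsMinimalFrame d m e fun i => w.get i := by
  intro h
  obtain ⟨hne, hoff, hlt⟩ := hc
  set N : (ℕ × ℕ × List ℕ) → ℝ := fun p =>
    ⟪∑ i, termVec d w p i • e i, ∑ i, termVec d w p i • e i⟫ with hN
  have hlow : (c.map fun p => (p.1 : ℝ) * (d ^ 2 * m)).sum ≤
      (c.map fun p => (p.1 : ℝ) * N p).sum := by
    refine List.sum_le_sum fun p hp => mul_le_mul_of_nonneg_left ?_ (Nat.cast_nonneg _)
    obtain ⟨i, hi⟩ := hne p hp
    refine h.le_inner _ (fun h0 => hi (congrFun h0 i)) p.2.1 fun i => ?_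
    exact_mod_cast rounding_sub_dvd d (p.2.1 * w.get i) _
  have hexp : (c.map fun p => (p.1 : ℝ) * N p).sum =
      ∑ i, ∑ j, ((c.map fun p => (p.1 : ℤ) * (termVec d w p i * termVec d w p j)).sum : ℤ)
        * ⟪e i, e j⟫ := by
    clear hne hoff hlt hlow
    induction c with
    | nil => simp
    | cons p c ih =>
      simp only [List.map_cons, List.sum_cons, ih, Int.cast_add, add_mul, Finset.sum_add_distrib]
      congr 1
      simp only [hN, sum_inner, inner_sum, Finset.mul_sum, ← Int.cast_smul_eq_zsmul ℝ,
        inner_smul_left, inner_smul_right]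
      refine Finset.sum_comm.trans ?_
      refine Finset.sum_congr rfl fun i _ => Finset.sum_congr rfl fun j _ => ?_
      push_cast
      simp only [RCLike.conj_to_real]
      ring
  have hdiag : (c.map fun p => (p.1 : ℝ) * N p).sum =
      ((c.map fun p => (p.1 : ℤ) * ∑ i, termVec d w p i ^ 2).sum : ℤ) * m := by
    have h1 : (c.map fun p => (p.1 : ℤ) * ∑ i, termVec d w p i ^ 2).sum =
        ∑ i, (c.map fun p => (p.1 : ℤ) * (termVec d w p i * termVec d w p i)).sum := by
      clear hne hoff hlt hlow hexp
      induction c with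
      | nil => simp
      | cons p c ih =>
        rw [List.map_cons, List.sum_cons, ih, Finset.mul_sum, ← Finset.sum_add_distrib]
        exact Finset.sum_congr rfl fun i _ => by simp [sq]
    rw [hexp, h1, Int.cast_sum, Finset.sum_mul]
    refine Finset.sum_congr rfl fun i _ => ?_
    rw [Finset.sum_eq_single i, h.inner_self]
    · intro j _ hj
      rw [hoff i j hj.symm]
      simp
    · simp
  have hscale : (c.map fun p => (p.1 : ℝ) * (d ^ 2 * m)).sum =
      ((c.map fun p => (p.1 : ℤ) * d ^ 2).sum : ℤ) * m := by
    clear hne hoff hlt hlow hexp hdiag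
    induction c with
    | nil => simp
    | cons p c ih =>
      simp only [List.map_cons, List.sum_cons, ih]
      push_cast
      ring
  rw [hscale, hdiag] at hlow
  exact absurd (Int.cast_le.mp (le_of_mul_le_mul_right hlow hm)) (not_le.mpr hlt)

end Frame

theorem weightedSum_one (k : ℕ) (l : List ℕ) : weightedSum (fun _ => 1) k l = l.sum := by
  induction l generalizing k with
  | nil => rfl
  | cons a l ih => rw [weightedSum, ih, mul_one, List.sum_cons]

theorem redAbs_le_half (d x : ℕ) : redAbs d x ≤ d / 2 := by
  unfold redAbs; omega

theorem redAbs_eq_zero {d : ℕ} (hd : 0 < d) {x : ℕ} : redAbs d x = 0 ↔ d ∣ x := by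
  have := Nat.mod_lt x hd
  rw [Nat.dvd_iff_mod_eq_zero]
  unfold redAbs; omega

theorem card_get_eq_count {α : Type*} [DecidableEq α] (l : List α) (c : α) :
    Fintype.card {j : Fin l.length // l.get j = c} = l.count c := by
  rw [Fintype.card_subtype]
  exact Fin.card_filter_univ_eq_vector_get_eq_count c ⟨l, rfl⟩

theorem exists_injective_get_eq {ι : Type*} [Fintype ι] {w : ι → ℕ} {l : List ℕ} (hl : 0 ∉ l)
    (h : ∀ k ≠ 0, l.count k = Fintype.card {i // w i = k}) :
    ∃ f : Fin l.length → ι, f.Injective ∧ (∀ j, w (f j) = l.get j) ∧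
      ∀ i ∉ Set.range f, w i = 0 := by
  have hcard : ∀ c, Nonempty ({j : Fin l.length // l.get j = c} ≃
      {i : {i // w i ≠ 0} // w i = c}) := fun c => by
    rw [← Fintype.card_eq, card_get_eq_count]
    rcases eq_or_ne c 0 with rfl | hc
    · rw [List.count_eq_zero_of_not_mem hl, eq_comm, Fintype.card_eq_zero_iff]
      exact ⟨fun i => i.1.2 i.2⟩
    · rw [h c hc]
      exact Fintype.card_congr
        (Equiv.subtypeSubtypeEquivSubtype fun {i} (hi : w i = c) => hi ▸ hc).symm
  let e : Fin l.length ≃ {i // w i ≠ 0} := Equiv.ofFiberEquiv fun c => (hcard c).some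
  refine ⟨fun j => e j, Subtype.val_injective.comp e.injective,
    Equiv.ofFiberEquiv_map (g := fun i : {i // w i ≠ 0} => w i) _,
    fun i hi => ?_⟩
  by_contra h0
  exact hi ⟨e.symm ⟨i, h0⟩, by simp⟩

theorem weightedSum_card {ι : Type*} [Fintype ι] {n : ℕ} {w : ι → ℕ} (hw : ∀ i, w i ≤ n)
    {g : ℕ → ℕ} (hg : g 0 = 0) :
    weightedSum g 1 ((List.range' 1 n).map fun k => Fintype.card {i // w i = k}) =
      ∑ i, g (w i) := by
  classical
  have hmaps : ∀ i ∈ Finset.univ, w i ∈ Finset.range (1 + n) := fun i _ => by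
    have := hw i
    simp; omega
  rw [weightedSum_map_range', ← Finset.sum_fiberwise_of_maps_to hmaps, Finset.range_eq_Ico,
    Finset.sum_eq_sum_Ico_succ_bot (by omega : 0 < 1 + n), Finset.sum_eq_zero (s := {i | w i = 0}),
    zero_add]
  · refine Finset.sum_congr rfl fun k _ => ?_
    rw [Fintype.card_subtype, ← smul_eq_mul, ← Finset.sum_const]
    exact Finset.sum_congr rfl fun i hi => by rw [(Finset.mem_filter.mp hi).2]
  · intro i hi
    rw [(Finset.mem_filter.mp hi).2, hg]

theorem IsMinimalFrame.exists_dvd {E : Type*} [NormedAddCommGroup E] [InnerProductSpace ℝ E]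
    {ι : Type*} [Fintype ι] {d : ℕ} {m : ℝ} {e : ι → E} {a : ι → ℤ}
    (h : IsMinimalFrame d m e a) (hm : 0 < m) (hd : d ∈ [7, 8, 9, 10, 12])
    (hι : Fintype.card ι ≤ 8) : ∃ t < d, t ≠ 0 ∧ ∀ i, (d : ℤ) ∣ t * a i := by
  have hd0 : 0 < d := by
    rcases d.eq_zero_or_pos with rfl | h
    · simp at hd
    · exact h
  by_contra! horder
  set w : ι → ℕ := fun i => redAbs d (a i % d).toNat with hwdef
  have haw : ∀ i, (d : ℤ) ∣ a i - w i ∨ (d : ℤ) ∣ a i + w i := fun i => by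
    have h1 : (((a i % d).toNat : ℕ) : ℤ) = a i % d :=
      Int.toNat_of_nonneg (Int.emod_nonneg _ (by exact_mod_cast hd0.ne'))
    have h2 : (d : ℤ) ∣ a i - a i % d := Int.dvd_self_sub_emod
    rcases dvd_sub_redAbs_or hd0 (a i % d).toNat with h3 | h3
    · exact .inl ((dvd_add h2 h3).trans (dvd_of_eq (by rw [h1]; ring)))
    · exact .inr ((dvd_add h2 h3).trans (dvd_of_eq (by rw [h1]; ring)))
  obtain ⟨e₁, h₁⟩ := h.exists_signs 1 (b := fun i => w i) (by simpa using haw)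
  have hmul : ∀ t : ℕ, ∃ e' : ι → E, IsMinimalFrame d m e' fun i => redAbs d (t * w i) := fun t =>
    h₁.exists_signs t fun i => by
      have := dvd_sub_redAbs_or hd0 (t * w i)
      push_cast at this ⊢
      exact this
  have hwat : ∀ t < d, t ≠ 0 → 2 * d ≤ ∑ i, redAbs d (t * w i) := fun t ht ht0 => by
    obtain ⟨e', h'⟩ := hmul t
    obtain ⟨i, hi⟩ := horder t ht ht0
    refine h'.two_mul_le_sum hm (fun i => ?_) (i₀ := i) fun h0 => hi ?_
    · have := redAbs_le_half d (t * w i)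
      omega
    · rw [redAbs_eq_zero hd0] at h0
      have h0 : (d : ℤ) ∣ t * w i := by exact_mod_cast h0
      rcases haw i with h3 | h3
      · exact (dvd_add (h3.mul_left t) h0).trans (dvd_of_eq (by ring))
      · exact (dvd_sub (h3.mul_left t) h0).trans (dvd_of_eq (by ring))
  have hhalf : ∀ i, w i ≤ d / 2 := fun i => redAbs_le_half _ _
  set x : List ℕ := (List.range' 1 (d / 2)).map fun k => Fintype.card {i // w i = k} with hx
  have hsum : x.sum ≤ 8 := by
    have h1 : x.sum = weightedSum (fun k => if k = 0 then 0 else 1) 1 x := by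
      rw [hx, weightedSum_map_range', ← weightedSum_one 1, weightedSum_map_range']
      refine Finset.sum_congr rfl fun k hk => ?_
      rw [if_neg (by simp at hk; omega)]
    rw [h1, weightedSum_card hhalf rfl]
    refine le_trans (Finset.sum_le_card_nsmul _ _ 1 fun i _ => ?_) (by simpa using hι)
    split_ifs <;> simp
  obtain ⟨t, -, p, hp, hcount⟩ := exists_mem_certificates hd (x := x) (by simp [hx]) hsum
    fun t ht ht0 => by
      rw [weightedSum_card hhalf (by simp [redAbs])]
      exact hwat t ht ht0
  obtain ⟨hpw, hpc⟩ := isCertificate_of_mem_certificates d hd p hp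
  obtain ⟨e', h'⟩ := hmul t
  obtain ⟨f, hf, hfw, hf0⟩ := exists_injective_get_eq (w := fun i => redAbs d (t * w i)) (l := p.1)
    (fun h0 => (hpw 0 h0).1 rfl) fun k hk => by
      rcases lt_or_ge k (d / 2 + 1) with hkd | hkd
      · rw [hcount k hkd hk, weightedSum_card hhalf (by simp [redAbs, hk.symm]),
          Fintype.card_subtype, Finset.card_filter]
      · rw [List.count_eq_zero_of_not_mem, eq_comm, Fintype.card_eq_zero_iff]
        · refine ⟨fun i => ?_⟩
          have := i.2 ▸ redAbs_le_half d (t * w i)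
          omega
        · intro hk
          have := (hpw k hk).2
          omega
  refine hpc.not_isMinimalFrame hm (e := e' ∘ f) ?_
  convert h'.comp_injective hf fun i hi => ?_ using 1
  · funext j
    simp [hfw]
  · exact_mod_cast hf0 i hi

theorem latticeMin_le {n : ℕ} {Λ : Submodule ℤ (EuclideanSpace ℝ (Fin n))}
    {x : EuclideanSpace ℝ (Fin n)} (hx : x ∈ Λ) (hx0 : x ≠ 0) : latticeMin Λ ≤ ⟪x, x⟫ :=
  csInf_le ⟨0, by rintro _ ⟨y, -, -, rfl⟩; exact real_inner_self_nonneg⟩ ⟨x, hx, hx0, rfl⟩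

theorem IsMinkowskian.exists_isMinimalFrame {n d : ℕ} (hd : 1 < d)
    {Λ Λ' : Submodule ℤ (EuclideanSpace ℝ (Fin n))} (h : IsMinkowskian Λ Λ')
    (φ : quotLat Λ Λ' ≃+ ZMod d) :
    0 < latticeMin Λ ∧ ∃ (e : Fin n → EuclideanSpace ℝ (Fin n)) (a : Fin n → ℤ),
      IsMinimalFrame d (latticeMin Λ) e a ∧
        ∀ t : ℤ, (∀ i, (d : ℤ) ∣ t * a i) → (d : ℤ) ∣ t := by
  obtain ⟨e, hli, he, rfl⟩ := h
  obtain ⟨q, hq⟩ := φ.surjective 1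
  obtain ⟨g, rfl⟩ := Submodule.Quotient.mk_surjective _ q
  have hmem : ∀ k : ℤ, k • (g : EuclideanSpace ℝ (Fin n)) ∈ Submodule.span ℤ (Set.range e) ↔
      (d : ℤ) ∣ k := fun k => by
    rw [← ZMod.intCast_zmod_eq_zero_iff_dvd]
    have h1 : φ (Submodule.Quotient.mk (k • g)) = k := by
      rw [Submodule.Quotient.mk_smul, map_zsmul, hq, zsmul_one]
    rw [← h1, map_eq_zero_iff φ φ.injective, Submodule.Quotient.mk_eq_zero]
    rfl
  obtain ⟨a, ha⟩ := (Submodule.mem_span_range_iff_exists_fun ℤ).mp ((hmem d).mpr dvd_rfl)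
  have hd0 : (d : ℝ) ≠ 0 := by exact_mod_cast (zero_lt_one.trans hd).ne'
  have hsmul : ∀ y : EuclideanSpace ℝ (Fin n), (d : ℝ) • y = (d : ℤ) • y := fun y => by
    rw [Nat.cast_smul_eq_nsmul, natCast_zsmul]
  have horder : ∀ t : ℤ, (∀ i, (d : ℤ) ∣ t * a i) → (d : ℤ) ∣ t := fun t ht => by
    choose b hb using ht
    rw [← hmem, Submodule.mem_span_range_iff_exists_fun]
    refine ⟨b, smul_right_injective _ hd0 ?_⟩
    simp only [hsmul]
    rw [smul_comm, ← ha, Finset.smul_sum, Finset.smul_sum]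
    exact Finset.sum_congr rfl fun i _ => by rw [smul_smul, smul_smul, hb]
  have heΛ : ∀ i, ⟪e i, e i⟫ = latticeMin Λ := fun i => (he i).2.2
  refine ⟨?_, e, a, ⟨heΛ, fun z hz t ht => ?_⟩, horder⟩
  · have h1 : ¬ ∀ i, (d : ℤ) ∣ 1 * a i := fun h1 => by
      have := Int.le_of_dvd one_pos (horder 1 h1)
      omega
    push Not at h1
    obtain ⟨i, -⟩ := h1
    rw [← heΛ i]
    exact real_inner_self_pos.mpr (he i).2.1
  · choose b hb using ht
    set x : EuclideanSpace ℝ (Fin n) := t • (g : EuclideanSpace ℝ (Fin n)) + ∑ i, b i • e i with hx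
    have hxd : (d : ℝ) • x = ∑ i, z i • e i := by
      rw [hsmul, hx, smul_add, smul_comm, ← ha, Finset.smul_sum,
        Finset.smul_sum, ← Finset.sum_add_distrib]
      refine Finset.sum_congr rfl fun i _ => ?_
      rw [smul_smul, smul_smul, ← add_smul, ← hb, add_sub_cancel]
    have hxΛ : x ∈ Λ := Λ.add_mem (Λ.smul_mem _ g.2)
      (Λ.sum_mem fun i _ => Λ.smul_mem _ (he i).1)
    have hx0 : x ≠ 0 := fun h0 => hz (funext fun i => by
      rw [h0, smul_zero] at hxd
      have := Fintype.linearIndependent_iff.mp hli (fun i => (z i : ℝ))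
        (by simpa only [Int.cast_smul_eq_zsmul] using hxd.symm) i
      exact_mod_cast this)
    rw [← hxd, inner_smul_left, inner_smul_right, RCLike.conj_to_real, ← mul_assoc, ← sq]
    exact mul_le_mul_of_nonneg_left (latticeMin_le hxΛ hx0) (sq_nonneg _)

theorem IsMinkowskian.isEmpty_addEquiv {n d : ℕ} (hn : n ≤ 8) (hd : d ∈ [7, 8, 9, 10, 12])
    {Λ Λ' : Submodule ℤ (EuclideanSpace ℝ (Fin n))} (h : IsMinkowskian Λ Λ') :
    IsEmpty (quotLat Λ Λ' ≃+ ZMod d) := by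
  refine ⟨fun φ => ?_⟩
  obtain ⟨hm, e, a, hea, ha⟩ := h.exists_isMinimalFrame (by simp at hd; omega) φ
  obtain ⟨t, htd, ht0, ht⟩ := hea.exists_dvd hm hd (by simpa using hn)
  exact ht0 (Nat.eq_zero_of_dvd_of_lt (by exact_mod_cast ha t ht) htd)

/-- The inclusion of `ℤⁿ` in `ℝⁿ`. -/
def intEmbedding (n : ℕ) : (Fin n → ℤ) →ₗ[ℤ] EuclideanSpace ℝ (Fin n) where
  toFun v := WithLp.toLp 2 fun i => (v i : ℝ)
  map_add' u v := by ext; simp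
  map_smul' k v := by ext; simp

theorem inner_intEmbedding {n : ℕ} (u v : Fin n → ℤ) :
    ⟪intEmbedding n u, intEmbedding n v⟫ = ((u ⬝ᵥ v : ℤ) : ℝ) := by
  simp [intEmbedding, PiLp.inner_apply, dotProduct, mul_comm]

theorem intEmbedding_injective (n : ℕ) : Function.Injective (intEmbedding n) := fun u v h => by
  ext i
  simpa [intEmbedding] using congrArg (fun x => x i) h

/-- The lattice in `ℝⁿ` generated by the rows of an integer matrix. -/
def rowLattice {n : ℕ} (M : Matrix (Fin n) (Fin n) ℤ) : Submodule ℤ (EuclideanSpace ℝ (Fin n)) :=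
  LinearMap.range (intEmbedding n ∘ₗ M.vecMulLinear)

theorem rowLattice_eq_span {n : ℕ} (M : Matrix (Fin n) (Fin n) ℤ) :
    rowLattice M = Submodule.span ℤ (Set.range fun i => intEmbedding n (M i)) := by
  rw [rowLattice, LinearMap.range_comp, range_vecMulLinear, Submodule.map_span, ← Set.range_comp]
  rfl

theorem linearIndependent_intEmbedding {n : ℕ} {M N : Matrix (Fin n) (Fin n) ℤ} {k : ℤ}
    (hk : k ≠ 0) (h : M * N = k • 1) : LinearIndependent ℝ fun i => intEmbedding n (M i) := by
  have hdet : (M.map (Int.cast : ℤ → ℝ)).det ≠ 0 := by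
    have h1 : M.det ≠ 0 := fun h0 => by
      have := congrArg Matrix.det h
      rw [Matrix.det_mul, h0, zero_mul, Matrix.det_smul, Matrix.det_one, mul_one] at this
      exact pow_ne_zero _ hk this.symm
    have h2 : (M.map (Int.cast : ℤ → ℝ)).det = (M.det : ℝ) := (Int.cast_det M).symm
    rw [h2]
    exact_mod_cast h1
  have := Matrix.linearIndependent_rows_of_det_ne_zero hdet
  exact this.map' (WithLp.linearEquiv 2 ℝ (Fin n → ℝ)).symm.toLinearMap (LinearEquiv.ker _)

theorem isLattice_rowLattice {n : ℕ} {M N : Matrix (Fin n) (Fin n) ℤ} {k : ℤ}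
    (hk : k ≠ 0) (h : M * N = k • 1) : IsLattice (rowLattice M) := by
  have hli := linearIndependent_intEmbedding hk h
  have hspan := hli.span_eq_top_of_card_eq_finrank' (by simp)
  let b := Module.Basis.mk hli hspan.ge
  have hb : rowLattice M = Submodule.span ℤ (Set.range b) := by
    rw [Module.Basis.coe_mk, rowLattice_eq_span]
  refine ⟨?_, ?_⟩
  · rw [hb]; infer_instance
  · rw [rowLattice_eq_span, Submodule.span_span_of_tower, hspan]

theorem vecMul_injective {n : ℕ} {M N : Matrix (Fin n) (Fin n) ℤ} {k : ℤ}
    (hk : k ≠ 0) (h : M * N = k • 1) : Function.Injective M.vecMulLinear := fun x y hxy => by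
  have h1 := congrArg (Matrix.vecMul · N) hxy
  simp only [Matrix.vecMulLinear_apply, Matrix.vecMul_vecMul, h, Matrix.vecMul_smul,
    Matrix.vecMul_one] at h1
  exact smul_right_injective _ hk h1

/-- The quotient of `ℤⁿ`, embedded in some group, by the span of the rows of `E` is cyclic of order
`d` if `E` has an inverse `G` up to the factor `d` whose rows are multiples of one row modulo
`d`. -/
theorem nonempty_quotient_addEquiv_zmod {V : Type*} [AddCommGroup V] {n d : ℕ} [NeZero d]
    {T : (Fin n → ℤ) →ₗ[ℤ] V} (hT : Function.Injective T) {E G : Matrix (Fin n) (Fin n) ℤ}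
    (hGE : G * E = (d : ℤ) • 1) {f : Fin n → ℤ} {i₀ : Fin n} (hf : f i₀ = 1)
    (hEf : ∀ i, (d : ℤ) ∣ E.mulVec f i) (hGf : ∀ i j, (d : ℤ) ∣ G i j - f i * G i₀ j) :
    Nonempty ((LinearMap.range T ⧸ Submodule.comap (LinearMap.range T).subtype
      (Submodule.span ℤ (Set.range fun i => T (E i)))) ≃+ ZMod d) := by
  let ψ : (Fin n → ℤ) →ₗ[ℤ] ZMod d :=
    (Int.castAddHom (ZMod d)).toIntLinearMap ∘ₗ Fintype.linearCombination ℤ f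
  have hψ : ∀ x, ψ x = 0 ↔ (d : ℤ) ∣ x ⬝ᵥ f := fun x => by
    rw [← ZMod.intCast_zmod_eq_zero_iff_dvd]
    simp [ψ, Fintype.linearCombination_apply, dotProduct]
  let e := LinearEquiv.ofInjective T hT
  have hsurj : Function.Surjective (ψ ∘ₗ e.symm.toLinearMap) := by
    rw [LinearMap.coe_comp]
    refine Function.Surjective.comp (g := ψ) (fun c => ?_) e.symm.surjective
    obtain ⟨k, rfl⟩ := ZMod.intCast_surjective c
    exact ⟨Pi.single i₀ k, by simp [ψ, hf]⟩
  have hker : Submodule.comap (LinearMap.range T).subtype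
      (Submodule.span ℤ (Set.range fun i => T (E i))) =
      LinearMap.ker (ψ ∘ₗ e.symm.toLinearMap) := by
    ext y
    obtain ⟨x, rfl⟩ := e.surjective y
    have hmem : (e x : V) ∈ Submodule.span ℤ (Set.range fun i => T (E i)) ↔
        ∃ c : Fin n → ℤ, Matrix.vecMul c E = x := by
      rw [Submodule.mem_span_range_iff_exists_fun]
      refine exists_congr fun c => ?_
      rw [Matrix.vecMul_eq_sum, ← hT.eq_iff, map_sum]
      simp only [map_smul]
      rfl
    simp only [Submodule.mem_comap, Submodule.coe_subtype, hmem, LinearMap.mem_ker,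
      LinearMap.comp_apply, LinearEquiv.coe_coe, LinearEquiv.symm_apply_apply, hψ]
    constructor
    · rintro ⟨c, rfl⟩
      rw [← Matrix.dotProduct_mulVec]
      exact Finset.dvd_sum fun i _ => (hEf i).mul_left _
    · intro hx
      have hG : ∀ j, (d : ℤ) ∣ Matrix.vecMul x G j := fun j => by
        have h1 : Matrix.vecMul x G j =
            ∑ i, x i * (G i j - f i * G i₀ j) + (x ⬝ᵥ f) * G i₀ j := by
          simp only [Matrix.vecMul, dotProduct, mul_sub, Finset.sum_sub_distrib, Finset.sum_mul,
            mul_assoc, sub_add_cancel]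
        rw [h1]
        exact dvd_add (Finset.dvd_sum fun i _ => (hGf i j).mul_left _) (hx.mul_right _)
      choose c hc using hG
      refine ⟨c, smul_right_injective _ (NeZero.ne (d : ℤ)) ?_⟩
      have h2 : Matrix.vecMul x G = (d : ℤ) • c := funext fun j => by simpa using hc j
      simp only
      rw [← Matrix.smul_vecMul, ← h2, Matrix.vecMul_vecMul, hGE, Matrix.vecMul_smul,
        Matrix.vecMul_one]
  exact ⟨((Submodule.quotEquivOfEq _ _ hker).trans
    (LinearMap.quotKerEquivOfSurjective _ hsurj)).toAddEquiv⟩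

/-- Generators of the lattice of the vectors `2 • u` and `(1, 1, 1, 1, 1, 1, 1, 1, 0) + 2 • u`,
where `u` runs through the vectors in `ℤ⁹` with even coordinate sum. -/
def gluedMatrix : Matrix (Fin 9) (Fin 9) ℤ :=
  !![1, 1, 1, 1, 1, 1, 1, 1, 0;
     0, 2, -2, 0, 0, 0, 0, 0, 0;
     0, 0, 2, -2, 0, 0, 0, 0, 0;
     0, 0, 0, 2, -2, 0, 0, 0, 0;
     0, 0, 0, 0, 2, -2, 0, 0, 0;
     0, 0, 0, 0, 0, 2, -2, 0, 0;
     0, 0, 0, 0, 0, 0, 2, -2, 0;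
     0, 0, 0, 0, 0, 0, 0, 2, -2;
     0, 0, 0, 0, 0, 0, 0, 2, 2]

/-- The inverse of `gluedMatrix` up to a factor `4`. -/
def gluedMatrixAdjugate : Matrix (Fin 9) (Fin 9) ℤ :=
  !![4, -2, -4, -6, -8, -10, -12, -7, -7;
     0, 2, 2, 2, 2, 2, 2, 1, 1;
     0, 0, 2, 2, 2, 2, 2, 1, 1;
     0, 0, 0, 2, 2, 2, 2, 1, 1;
     0, 0, 0, 0, 2, 2, 2, 1, 1;
     0, 0, 0, 0, 0, 2, 2, 1, 1;
     0, 0, 0, 0, 0, 0, 2, 1, 1;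
     0, 0, 0, 0, 0, 0, 0, 1, 1;
     0, 0, 0, 0, 0, 0, 0, -1, 1]

theorem gluedMatrix_mul : gluedMatrix * gluedMatrixAdjugate = (4 : ℤ) • 1 := by
  decide +kernel

theorem two_le_dotProduct_self {n : ℕ} {u : Fin n → ℤ} (hu : Even (∑ i, u i)) (hu0 : u ≠ 0) :
    2 ≤ u ⬝ᵥ u := by
  have h1 : Even (u ⬝ᵥ u) := by
    have h2 : u ⬝ᵥ u = ∑ i, u i * (u i + 1) - ∑ i, u i := by
      simp [dotProduct, mul_add, Finset.sum_add_distrib]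
    rw [h2]
    exact (Finset.even_sum _ fun i _ => Int.even_mul_succ_self _).sub hu
  have h3 : 0 < u ⬝ᵥ u := by
    refine lt_of_le_of_ne (Finset.sum_nonneg fun i _ => mul_self_nonneg _) fun h => hu0 ?_
    exact dotProduct_self_eq_zero.mp h.symm
  obtain ⟨k, hk⟩ := h1
  omega

theorem eight_le_dotProduct_self {v : Fin 9 → ℤ} (hv : ∀ i : Fin 8, Odd (v i.castSucc)) :
    8 ≤ v ⬝ᵥ v := by
  have h1 : ∀ i : Fin 8, 1 ≤ v i.castSucc * v i.castSucc := fun i => by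
    have h2 : v i.castSucc ≠ 0 := fun h0 => by simpa [h0] using hv i
    have := mul_self_pos.mpr h2
    omega
  rw [dotProduct, Fin.sum_univ_castSucc]
  have h2 := Finset.card_nsmul_le_sum Finset.univ _ 1 fun i _ => h1 i
  simp only [Finset.card_univ, Fintype.card_fin, nsmul_eq_mul] at h2
  have := mul_self_nonneg (v (Fin.last 8))
  push_cast at h2
  omega

theorem eight_le_norm_gluedMatrix {x : Fin 9 → ℤ} (hx : x ≠ 0) :
    8 ≤ Matrix.vecMul x gluedMatrix ⬝ᵥ Matrix.vecMul x gluedMatrix := by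
  have hv : Matrix.vecMul x gluedMatrix = ![x 0, x 0 + 2 * x 1, x 0 - 2 * x 1 + 2 * x 2,
      x 0 - 2 * x 2 + 2 * x 3, x 0 - 2 * x 3 + 2 * x 4, x 0 - 2 * x 4 + 2 * x 5,
      x 0 - 2 * x 5 + 2 * x 6, x 0 - 2 * x 6 + 2 * x 7 + 2 * x 8, -2 * x 7 + 2 * x 8] := by
    funext j
    fin_cases j <;> simp [Matrix.vecMul, dotProduct, Fin.sum_univ_succ, gluedMatrix] <;> ring
  rcases Int.even_or_odd' (x 0) with ⟨y, hy | hy⟩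
  · set u : Fin 9 → ℤ := ![y, y + x 1, y - x 1 + x 2, y - x 2 + x 3, y - x 3 + x 4, y - x 4 + x 5,
      y - x 5 + x 6, y - x 6 + x 7 + x 8, -x 7 + x 8] with hu
    have hvu : Matrix.vecMul x gluedMatrix = (2 : ℤ) • u := by
      rw [hv, hu]
      funext j
      fin_cases j <;> simp [hy] <;> ring
    have hu0 : u ≠ 0 := fun h0 => hx <| by
      refine vecMul_injective four_ne_zero gluedMatrix_mul ?_
      rw [Matrix.vecMulLinear_apply, hvu, h0, smul_zero, map_zero]
    have := two_le_dotProduct_self (u := u) ⟨4 * y + x 8, by simp [hu, Fin.sum_univ_succ]; ring⟩ hu0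
    rw [hvu, smul_dotProduct, dotProduct_smul, smul_eq_mul, smul_eq_mul]
    omega
  · refine eight_le_dotProduct_self fun i => ?_
    rw [hv, ← Int.not_even_iff_odd, Int.even_iff]
    fin_cases i <;> simp <;> omega

theorem latticeMin_rowLattice_gluedMatrix : latticeMin (rowLattice gluedMatrix) = 8 := by
  have hinner : ∀ x, ⟪(intEmbedding 9 ∘ₗ gluedMatrix.vecMulLinear) x,
      (intEmbedding 9 ∘ₗ gluedMatrix.vecMulLinear) x⟫ =
      ((Matrix.vecMul x gluedMatrix ⬝ᵥ Matrix.vecMul x gluedMatrix : ℤ) : ℝ) := fun x =>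
    inner_intEmbedding _ _
  refine IsLeast.csInf_eq ⟨⟨_, ⟨Pi.single 0 1, rfl⟩, fun h0 => ?_, ?_⟩, ?_⟩
  · have := hinner (Pi.single 0 1)
    rw [h0, inner_zero_left] at this
    have h8 := eight_le_norm_gluedMatrix (x := Pi.single 0 1) (by simp)
    rw [← Int.cast_zero, Int.cast_inj] at this
    omega
  · rw [hinner]
    exact_mod_cast (by decide +kernel : Matrix.vecMul (Pi.single 0 1) gluedMatrix ⬝ᵥ
      Matrix.vecMul (Pi.single 0 1) gluedMatrix = 8)
  · rintro _ ⟨_, ⟨x, rfl⟩, hx, rfl⟩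
    rw [hinner]
    exact_mod_cast eight_le_norm_gluedMatrix fun h0 : x = 0 => hx (by rw [h0, map_zero])

theorem exists_isMinkowskian_rowLattice {d : ℕ} [NeZero d] {E G : Matrix (Fin 9) (Fin 9) ℤ}
    {f : Fin 9 → ℤ} {i₀ : Fin 9} (hf : f i₀ = 1) (hEG : E * G = (d : ℤ) • 1)
    (hGE : G * E = (d : ℤ) • 1) (hEf : ∀ i, (d : ℤ) ∣ E.mulVec f i)
    (hGf : ∀ i j, (d : ℤ) ∣ G i j - f i * G i₀ j)
    (hE : ∀ i, (E * gluedMatrix) i ⬝ᵥ (E * gluedMatrix) i = 8) :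
    ∃ Λ Λ' : Submodule ℤ (EuclideanSpace ℝ (Fin 9)),
      IsLattice Λ ∧ IsMinkowskian Λ Λ' ∧ Nonempty (quotLat Λ Λ' ≃+ ZMod d) := by
  have hinj : Function.Injective (intEmbedding 9 ∘ₗ gluedMatrix.vecMulLinear) :=
    (intEmbedding_injective 9).comp (vecMul_injective four_ne_zero gluedMatrix_mul)
  have hmul : (E * gluedMatrix) * (gluedMatrixAdjugate * G) = (4 * d : ℤ) • 1 := by
    rw [Matrix.mul_assoc, ← Matrix.mul_assoc gluedMatrix, gluedMatrix_mul, Matrix.smul_mul,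
      Matrix.one_mul, Matrix.mul_smul, hEG, smul_smul]
  have hli := linearIndependent_intEmbedding
    (mul_ne_zero four_ne_zero (NeZero.ne (d : ℤ))) hmul
  refine ⟨rowLattice gluedMatrix, _, isLattice_rowLattice four_ne_zero gluedMatrix_mul,
    ⟨_, hli, fun i => ⟨⟨E i, rfl⟩, hli.ne_zero i, ?_⟩, rfl⟩,
    nonempty_quotient_addEquiv_zmod hinj hGE hf hEf hGf⟩
  rw [inner_intEmbedding, hE, latticeMin_rowLattice_gluedMatrix]
  norm_num

/-- For each `d ∈ {7, 8, 9, 10, 12}` there exists a lattice `Λ` in `ℝ⁹` with a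
Minkowskian sublattice `Λ'` such that `Λ/Λ'` is cyclic of order `d`; and none
of these cyclic quotient orders occurs for any lattice of dimension at
most `8`. -/
theorem cyclic_quotients_new_in_dim_nine :
    (∀ d ∈ ({7, 8, 9, 10, 12} : Set ℕ),
      ∃ Λ Λ' : Submodule ℤ (EuclideanSpace ℝ (Fin 9)),
        IsLattice Λ ∧ IsMinkowskian Λ Λ' ∧
          Nonempty (quotLat Λ Λ' ≃+ ZMod d)) ∧
    (∀ n ≤ 8, ∀ d ∈ ({7, 8, 9, 10, 12} : Set ℕ),
      ¬ ∃ Λ Λ' : Submodule ℤ (EuclideanSpace ℝ (Fin n)),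
        IsLattice Λ ∧ IsMinkowskian Λ Λ' ∧
          Nonempty (quotLat Λ Λ' ≃+ ZMod d)) := by
  refine ⟨?_, ?_⟩
  · rintro d (rfl | rfl | rfl | rfl | rfl)
    · exact exists_isMinkowskian_rowLattice (i₀ := 1)
        (E := !![0, 0, 0, 1, 1, 1, 1, 1, 1;
                 -1, 0, 1, 2, 2, 3, 4, 2, 2;
                 0, 0, 1, 1, 1, 0, 0, 0, 0;
                 0, 1, 1, 1, 1, 1, 0, 0, 0;
                 -1, 1, 2, 2, 3, 3, 4, 2, 2;
                 -1, 0, 1, 1, 2, 3, 3, 2, 2;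
                 -2, 1, 2, 3, 4, 4, 5, 3, 3;
                 0, 0, 0, 0, 1, 1, 1, 0, 1;
                 0, 0, 0, 0, 1, 1, 1, 1, 0])
        (G := !![7, 0, 0, 0, 7, 0, -7, 0, 0;
                 2, -3, -6, 2, 4, -3, 1, -1, -1;
                 -1, -2, 3, -1, 5, 5, -4, -3, -3;
                 2, 4, 1, 2, -3, -3, 1, -1, -1;
                 -1, -2, 3, -1, -2, -2, 3, 4, 4;
                 -2, 3, -1, 5, -4, 3, -1, 1, 1;
                 -2, 3, -1, -2, 3, -4, -1, 1, 1;
                 5, -4, -1, -2, 3, 3, -1, -6, 1;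
                 5, -4, -1, -2, 3, 3, -1, 1, -6])
        (f := ![0, 1, 3, 1, 3, -1, -1, -1, -1]) rfl
        (by decide +kernel) (by decide +kernel) (by decide +kernel) (by decide +kernel)
        (by decide +kernel)
    · exact exists_isMinkowskian_rowLattice (i₀ := 1)
        (E := !![-1, 0, 0, 0, 1, 2, 2, 1, 1;
                 1, 0, -1, -2, -2, -2, -2, -1, -1;
                 0, 0, 0, 1, 1, 1, 1, 1, 1;
                 0, 0, 0, 0, 0, 0, 1, 0, 1;
                 0, 0, 0, 0, -1, 0, 0, 0, 0;
                 0, 0, 1, 1, 2, 2, 2, 1, 1;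
                 0, 0, 0, 0, 0, 0, 1, 1, 0;
                 -2, 1, 2, 2, 3, 4, 5, 3, 3;
                 -1, 1, 1, 2, 2, 3, 4, 2, 2])
        (G := !![-2, 4, 2, 0, 2, 6, 0, -2, 2;
                 -3, 6, -1, -4, -5, -3, -4, 1, 7;
                 -4, 0, -4, 0, 4, 4, 0, 4, -4;
                 -2, -4, 2, 0, 2, -2, 0, -2, 2;
                 0, 0, 0, 0, -8, 0, 0, 0, 0;
                 3, 2, 1, -4, 5, 3, -4, -1, 1;
                 1, -2, -5, 4, -1, 1, 4, -3, 3;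
                 -1, 2, 5, -4, 1, -1, 4, 3, -3;
                 -1, 2, 5, 4, 1, -1, -4, 3, -3])
        (f := ![-2, 1, 4, -2, 0, -1, -3, 3, 3]) rfl
        (by decide +kernel) (by decide +kernel) (by decide +kernel) (by decide +kernel)
        (by decide +kernel)
    · exact exists_isMinkowskian_rowLattice (i₀ := 0)
        (E := !![0, 1, 2, 2, 2, 2, 2, 1, 1;
                 2, -1, -2, -3, -4, -5, -6, -4, -3;
                 0, 0, 1, 1, 1, 0, 0, 0, 0;
                 0, 0, 0, 0, 0, 0, -1, 0, 0;
                 0, 0, 0, 0, 1, 1, 1, 0, 0;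
                 -1, 0, 1, 1, 1, 2, 2, 1, 1;
                 0, 0, 0, 1, 1, 1, 1, 0, 0;
                 1, -1, -1, -2, -2, -2, -2, -1, -1;
                 -2, 1, 2, 3, 4, 5, 6, 3, 4])
        (G := !![6, -1, -3, 2, -2, -5, 6, 8, 1;
                 3, 1, -6, -2, 2, -4, -6, -8, -1;
                 3, 1, 3, -2, 2, 5, -6, 1, -1;
                 0, 0, 0, 0, -9, 0, 9, 0, 0;
                 -3, -1, 6, 2, 7, -5, -3, -1, 1;
                 3, 1, -6, 7, 2, 5, 3, 1, -1;
                 0, 0, 0, -9, 0, 0, 0, 0, 0;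
                 0, -6, 0, 3, -3, -3, 0, 3, -3;
                 0, 3, 0, 3, -3, -3, 0, 3, 6])
        (f := ![1, -1, -1, 0, 1, -1, 0, -3, -3]) rfl
        (by decide +kernel) (by decide +kernel) (by decide +kernel) (by decide +kernel)
        (by decide +kernel)
    · exact exists_isMinkowskian_rowLattice (i₀ := 4)
        (E := !![0, 0, 0, 0, 1, 1, 1, 0, 1;
                 2, -1, -2, -3, -4, -6, -7, -4, -4;
                 0, 0, 0, 0, 1, 1, 1, 1, 0;
                 1, 0, -1, -2, -3, -3, -4, -2, -2;
                 -1, 1, 1, 2, 2, 2, 3, 2, 2;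
                 0, -1, -2, -2, -2, -2, -2, -1, -1;
                 -1, 0, 1, 1, 1, 1, 1, 1, 1;
                 0, 0, -1, -1, -1, -1, -2, -1, -1;
                 1, -1, -1, -1, -1, -1, -2, -1, -1])
        (G := !![2, 0, 2, 4, 4, -2, -4, -6, 6;
                 2, 0, 2, 4, 4, -2, -4, 4, -4;
                 2, 0, 2, 4, -6, -2, 6, -6, -4;
                 -8, 0, -8, -6, 4, -2, -4, 4, 6;
                 6, 5, 6, -3, 2, -1, 3, 2, -2;
                 -2, -5, -2, 1, -4, -3, -1, 6, 4;
                 -2, 0, -2, -4, -4, 2, -6, -4, -6;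
                 -2, 0, 8, 6, 6, 2, 4, -4, 4;
                 8, 0, -2, 6, 6, 2, 4, -4, 4])
        (f := ![2, 2, 2, 2, 1, 3, -2, -2, -2]) rfl
        (by decide +kernel) (by decide +kernel) (by decide +kernel) (by decide +kernel)
        (by decide +kernel)
    · exact exists_isMinkowskian_rowLattice (i₀ := 3)
        (E := !![0, 1, 2, 2, 2, 2, 2, 1, 1;
                 2, -1, -2, -3, -4, -5, -6, -4, -3;
                 0, 0, 1, 1, 1, 0, 0, 0, 0;
                 0, 0, 0, 0, 0, 0, -1, 0, 0;
                 0, 0, 0, 0, 1, 1, 1, 0, 0;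
                 -1, 0, 1, 1, 1, 2, 2, 1, 1;
                 0, 1, 1, 0, 0, 0, 0, 0, 0;
                 1, -1, -1, -2, -2, -2, -2, -1, -1;
                 -2, 1, 2, 3, 4, 5, 6, 3, 4])
        (G := !![12, 0, -6, 0, 0, -6, -6, 6, 0;
                 0, 0, -6, 0, 0, -6, 6, -6, 0;
                 0, 0, 6, 0, 0, 6, 6, 6, 0;
                 6, 2, -3, -4, -8, 1, -9, -7, -2;
                 -6, -2, 9, 4, 8, -7, 3, 1, 2;
                 6, 2, -9, 8, 4, 7, -3, -1, -2;
                 0, 0, 0, -12, 0, 0, 0, 0, 0;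
                 0, -8, 0, 4, -4, -4, 0, 4, -4;
                 0, 4, 0, 4, -4, -4, 0, 4, 8])
        (f := ![6, 6, 6, 1, 5, -5, 0, -4, -4]) rfl
        (by decide +kernel) (by decide +kernel) (by decide +kernel) (by decide +kernel)
        (by decide +kernel)
  · rintro n hn d hd ⟨Λ, Λ', -, h, ⟨φ⟩⟩
    exact (h.isEmpty_addEquiv hn (by simpa using hd)).false φ
end
end

section
/- There exists a lattice Λ in ℝ⁹ possessing a Minkowskian sublattice Λ' with Λ/Λ' ≅ (ℤ/4ℤ) × (ℤ/4ℤ); such a quotient of type 4² occurs for the perfect lattice L₈₁ (with s(L₈₁) = 81), whose quotient is generated over Λ' = ℤe₁ + … + ℤe₉ by the two vectors (e₁+e₂+e₃+e₄+2e₅+2e₆+2e₇)/4 and (e₂−e₃+2e₄+2e₅+e₇+2e₈+e₉)/4. -/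
open scoped BigOperators RealInnerProductSpace

noncomputable section

namespace QuaternaryCode

/-- The first generator of the code, the numerators of the first glue vector. -/
def genA : Fin 9 → ℤ := ![1, 1, 1, 1, 2, 2, 2, 0, 0]

/-- The second generator of the code, the numerators of the second glue vector. -/
def genB : Fin 9 → ℤ := ![0, 1, -1, 2, 2, 0, 1, 2, 1]

/-- The codeword of `(ℤ/4)⁹` with coefficients `p` with respect to the two generators. -/
def codeword (p : ZMod 4 × ZMod 4) (i : Fin 9) : ZMod 4 := p.1 * genA i + p.2 * genB i

/-- Coordinates `0` and `8` form an information set of the code. -/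
def info : (Fin 9 → ℤ) →ₗ[ℤ] ZMod 4 × ZMod 4 where
  toFun y := (y 0, y 8)
  map_add' y z := by simp
  map_smul' c y := by simp

/-- The integral vectors that reduce modulo `4` to a codeword. -/
def codeLattice : Submodule ℤ (Fin 9 → ℤ) where
  carrier := {y | ∀ i, (y i : ZMod 4) = codeword (info y) i}
  add_mem' {y z} hy hz i := by
    simp only [Set.mem_ofPred_eq] at hy hz
    simp only [Pi.add_apply, Int.cast_add, hy i, hz i, map_add, codeword, Prod.fst_add,
      Prod.snd_add]
    ring
  zero_mem' i := by simp [codeword]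
  smul_mem' c y hy i := by
    simp only [Set.mem_ofPred_eq] at hy
    rw [Pi.smul_apply, smul_eq_mul, Int.cast_mul, hy i, map_smul]
    simp only [codeword, Prod.smul_fst, Prod.smul_snd]
    simp only [zsmul_eq_mul]
    ring

theorem mem_codeLattice {y : Fin 9 → ℤ} :
    y ∈ codeLattice ↔ ∀ i, (y i : ZMod 4) = codeword (info y) i := Iff.rfl

theorem info_genA : info genA = (1, 0) := by decide

theorem info_genB : info genB = (0, 1) := by decide

theorem genA_mem : genA ∈ codeLattice := by
  rw [mem_codeLattice, info_genA]; decide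

theorem genB_mem : genB ∈ codeLattice := by
  rw [mem_codeLattice, info_genB]; decide

theorem info_surjective_on (p : ZMod 4 × ZMod 4) : ∃ y ∈ codeLattice, info y = p := by
  obtain ⟨a, ha⟩ := ZMod.intCast_surjective p.1
  obtain ⟨b, hb⟩ := ZMod.intCast_surjective p.2
  refine ⟨a • genA + b • genB, add_mem (codeLattice.smul_mem a genA_mem)
    (codeLattice.smul_mem b genB_mem), ?_⟩
  rw [map_add, map_smul, map_smul, info_genA, info_genB]
  ext <;> simp [ha, hb]

/-- A vector of the code lattice has trivial information part iff it is a multiple of `4`. -/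
theorem exists_eq_four_smul_iff {y : Fin 9 → ℤ} :
    (y ∈ codeLattice ∧ info y = 0) ↔ ∃ z : Fin 9 → ℤ, y = (4 : ℤ) • z := by
  constructor
  · rintro ⟨hy, h0⟩
    have h : ∀ i, ∃ k, y i = 4 * k := fun i =>
      (ZMod.intCast_zmod_eq_zero_iff_dvd (y i) 4).1 (by simp [hy i, h0, codeword])
    choose z hz using h
    exact ⟨z, funext hz⟩
  · rintro ⟨z, rfl⟩
    have h4 : (4 : ZMod 4) = 0 := by decide
    have h0 : info ((4 : ℤ) • z) = 0 := by ext <;> simp [info, h4]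
    refine ⟨fun i => ?_, h0⟩
    rw [h0]
    simp [codeword, h4]

/-- The smallest square of an integer in a class modulo `4`. -/
def minSq : ZMod 4 → ℤ := ![0, 1, 4, 1]

/-- The shortest integers in a class modulo `4`. -/
def shortLifts : ZMod 4 → Finset ℤ := ![{0}, {1}, {2, -2}, {-1}]

theorem minSq_le_and_eq_iff (y : ℤ) :
    minSq y ≤ y ^ 2 ∧ (minSq y = y ^ 2 ↔ y ∈ shortLifts y) := by
  obtain ⟨k, r, hr0, hr4, rfl⟩ : ∃ k r : ℤ, 0 ≤ r ∧ r < 4 ∧ y = 4 * k + r :=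
    ⟨y / 4, y % 4, by lia, by lia, by lia⟩
  have hc : ((4 * k + r : ℤ) : ZMod 4) = (r : ZMod 4) := by
    simp [show (4 : ZMod 4) = 0 by decide]
  rw [hc]
  interval_cases r
  · change 0 ≤ _ ∧ (0 = _ ↔ _ ∈ ({0} : Finset ℤ))
    rw [Finset.mem_singleton]
    exact ⟨by positivity, by constructor <;> intro h <;> nlinarith⟩
  · change 1 ≤ _ ∧ (1 = _ ↔ _ ∈ ({1} : Finset ℤ))
    rw [Finset.mem_singleton]
    have : 0 ≤ k * (2 * k + 1) := by
      rcases le_or_gt 0 k with h | h <;> nlinarith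
    refine ⟨by nlinarith, fun h => ?_, fun h => by rw [h]; rfl⟩
    have : k * (2 * k + 1) = 0 := by linarith
    rcases mul_eq_zero.1 this with h | h <;> lia
  · change 4 ≤ _ ∧ (4 = _ ↔ _ ∈ ({2, -2} : Finset ℤ))
    rw [Finset.mem_insert, Finset.mem_singleton]
    have : 0 ≤ k * (k + 1) := by
      rcases le_or_gt 0 k with h | h <;> nlinarith
    refine ⟨by nlinarith, fun h => ?_, fun h => by rcases h with h | h <;> rw [h] <;> rfl⟩
    have : k * (k + 1) = 0 := by linarith
    rcases mul_eq_zero.1 this with h | h <;> lia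
  · change 1 ≤ _ ∧ (1 = _ ↔ _ ∈ ({-1} : Finset ℤ))
    rw [Finset.mem_singleton]
    have : 0 ≤ (k + 1) * (2 * k + 1) := by
      rcases le_or_gt 0 k with h | h <;> nlinarith
    refine ⟨by nlinarith, fun h => ?_, fun h => by rw [h]; rfl⟩
    have : (k + 1) * (2 * k + 1) = 0 := by linarith
    rcases mul_eq_zero.1 this with h | h <;> lia

theorem intCast_of_mem_shortLifts {r : ZMod 4} {y : ℤ} (h : y ∈ shortLifts r) :
    (y : ZMod 4) = r := by
  revert y
  revert r
  decide

/-- All nonzero codewords have Euclidean weight `16`. -/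
theorem sum_minSq_codeword {p : ZMod 4 × ZMod 4} (hp : p ≠ 0) :
    ∑ i, minSq (codeword p i) = 16 := by
  revert p
  decide

theorem sixteen_le_sum_sq {y : Fin 9 → ℤ} (hy : y ∈ codeLattice) (h0 : y ≠ 0) :
    16 ≤ ∑ i, y i ^ 2 := by
  by_cases hp : info y = 0
  · obtain ⟨z, rfl⟩ := exists_eq_four_smul_iff.1 ⟨hy, hp⟩
    obtain ⟨j, hj⟩ : ∃ j, z j ≠ 0 := by
      by_contra! h
      exact h0 (by simp [show z = 0 from funext h])
    have h1 : ((4 : ℤ) • z) j ^ 2 ≤ ∑ i, ((4 : ℤ) • z) i ^ 2 :=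
      Finset.single_le_sum (f := fun i => ((4 : ℤ) • z) i ^ 2) (fun i _ => sq_nonneg _)
        (Finset.mem_univ j)
    have h2 : 0 < z j ^ 2 := by positivity
    simp only [Pi.smul_apply, smul_eq_mul] at h1 ⊢
    nlinarith
  · rw [← sum_minSq_codeword hp]
    exact Finset.sum_le_sum fun i _ => hy i ▸ (minSq_le_and_eq_iff (y i)).1

/-- The vectors of norm `16` of the code lattice above a given codeword. -/
def shortVectors (p : ZMod 4 × ZMod 4) : Finset (Fin 9 → ℤ) :=
  if p = 0 then
    (Finset.univ : Finset (Fin 9 × ℤˣ)).image fun q => Pi.single q.1 (4 * (q.2 : ℤ))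
  else Fintype.piFinset fun i => shortLifts (codeword p i)

theorem mem_shortVectors_iff {p : ZMod 4 × ZMod 4} {y : Fin 9 → ℤ} :
    y ∈ shortVectors p ↔ y ∈ codeLattice ∧ info y = p ∧ ∑ i, y i ^ 2 = 16 := by
  unfold shortVectors
  split_ifs with hp
  · subst hp
    simp only [Finset.mem_image, Finset.mem_univ, true_and]
    constructor
    · rintro ⟨⟨j, u⟩, rfl⟩
      obtain ⟨h1, h2⟩ := exists_eq_four_smul_iff.2
        ⟨Pi.single j (u : ℤ), by rw [← Pi.single_smul, smul_eq_mul]⟩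
      refine ⟨h1, h2, ?_⟩
      rw [Finset.sum_eq_single j (fun i _ hi => by simp [hi]) (by simp), Pi.single_eq_same]
      rcases Int.units_eq_one_or u with rfl | rfl <;> norm_num
    · rintro ⟨h1, h2, h3⟩
      obtain ⟨z, rfl⟩ := exists_eq_four_smul_iff.1 ⟨h1, h2⟩
      simp only [Pi.smul_apply, smul_eq_mul, mul_pow, ← Finset.mul_sum] at h3
      have h4 : ∑ i, z i ^ 2 = 1 := by lia
      obtain ⟨j, hj⟩ : ∃ j, z j ≠ 0 := by
        by_contra! h
        simp [h] at h4
      rw [← Finset.add_sum_erase _ _ (Finset.mem_univ j)] at h4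
      have hj' : 0 < z j ^ 2 := by positivity
      have hs : 0 ≤ ∑ i ∈ Finset.univ.erase j, z i ^ 2 := Finset.sum_nonneg fun i _ => sq_nonneg _
      have h5 : ∑ i ∈ Finset.univ.erase j, z i ^ 2 = 0 := by lia
      rw [Finset.sum_eq_zero_iff_of_nonneg fun i _ => sq_nonneg _] at h5
      have h6 : z j * z j = 1 := by linarith [sq (z j)]
      refine ⟨⟨j, ⟨z j, z j, h6, h6⟩⟩, funext fun i => ?_⟩
      by_cases hi : i = j
      · subst hi; simp
      · simp [hi, (pow_eq_zero_iff two_ne_zero).1 (h5 i (by simp [hi]))]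
  · rw [Fintype.mem_piFinset]
    constructor
    · intro h
      have hc := fun i => intCast_of_mem_shortLifts (h i)
      have hi : info y = p := by
        refine Prod.ext ((hc 0).trans ?_) ((hc 8).trans ?_) <;> simp [codeword, genA, genB]
      refine ⟨fun i => by rw [hi, hc], hi, ?_⟩
      rw [← sum_minSq_codeword hp]
      refine Finset.sum_congr rfl fun i _ => ?_
      rw [← hc i]
      exact ((minSq_le_and_eq_iff (y i)).2.2 (by rw [hc i]; exact h i)).symm
    · rintro ⟨h1, rfl, h3⟩ i
      rw [← sum_minSq_codeword hp, eq_comm, Finset.sum_eq_sum_iff_of_le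
        fun i _ => h1 i ▸ (minSq_le_and_eq_iff (y i)).1] at h3
      rw [← h1 i]
      exact (minSq_le_and_eq_iff (y i)).2.1 (by rw [h1 i]; exact h3 i (Finset.mem_univ i))

theorem card_shortVectors_zero : (shortVectors 0).card = 18 := by
  rw [shortVectors, if_pos rfl, Finset.card_image_of_injective]
  · simp
  · rintro ⟨j, u⟩ ⟨k, v⟩ h
    have hu : (4 * (u : ℤ)) ≠ 0 := by simp
    have hj := congrFun h j
    simp only [Pi.single_eq_same] at hj
    by_cases hjk : j = k
    · subst hjk
      simp only [Pi.single_eq_same] at hj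
      exact Prod.ext rfl (Units.ext (by lia))
    · rw [Pi.single_eq_of_ne hjk] at hj
      exact absurd hj hu

theorem card_shortVectors_of_ne_zero {p : ZMod 4 × ZMod 4} (hp : p ≠ 0) :
    (shortVectors p).card = ∏ i, (shortLifts (codeword p i)).card := by
  rw [shortVectors, if_neg hp, Fintype.card_piFinset]

theorem card_biUnion_shortVectors : (Finset.univ.biUnion shortVectors).card = 162 := by
  rw [Finset.card_biUnion, ← Finset.add_sum_erase _ _ (Finset.mem_univ 0),
    card_shortVectors_zero, Finset.sum_congr rfl fun p hp =>
      card_shortVectors_of_ne_zero (Finset.ne_of_mem_erase hp)]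
  · decide
  · intro p _ q _ hpq
    refine Finset.disjoint_left.2 fun y hy hy' => hpq ?_
    rw [← (mem_shortVectors_iff.1 hy).2.1, (mem_shortVectors_iff.1 hy').2.1]

/-- The embedding of `ℤ⁹` into Euclidean space, scaled by `1/4`. -/
def quarter : (Fin 9 → ℤ) →ₗ[ℤ] EuclideanSpace ℝ (Fin 9) where
  toFun y := WithLp.toLp 2 fun i => (y i : ℝ) / 4
  map_add' y z := by ext i; simp [add_div]
  map_smul' c y := by ext i; simp [mul_div_assoc]

@[simp]
theorem quarter_apply (y : Fin 9 → ℤ) (i : Fin 9) : quarter y i = (y i : ℝ) / 4 := rfl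

theorem quarter_injective : Function.Injective quarter := by
  intro y z h
  ext i
  have := congrArg (fun v : EuclideanSpace ℝ (Fin 9) => v i) h
  simp only [quarter_apply] at this
  exact_mod_cast (div_left_inj' (by norm_num : (4 : ℝ) ≠ 0)).1 this

theorem inner_quarter (y : Fin 9 → ℤ) :
    ⟪quarter y, quarter y⟫ = ((∑ i, y i ^ 2 : ℤ) : ℝ) / 16 := by
  simp only [PiLp.inner_apply, quarter_apply, RCLike.inner_apply, conj_trivial, Int.cast_sum,
    Int.cast_pow, Finset.sum_div]
  exact Finset.sum_congr rfl fun i _ => by ring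

theorem quarter_four_smul_single (i : Fin 9) :
    quarter ((4 : ℤ) • Pi.single i 1) = EuclideanSpace.single i 1 := by
  ext j
  by_cases h : j = i
  · subst h; simp
  · simp [h]

theorem four_smul_single_mem_shortVectors (i : Fin 9) :
    (4 : ℤ) • (Pi.single i 1 : Fin 9 → ℤ) ∈ shortVectors 0 := by
  rw [shortVectors, if_pos rfl]
  exact Finset.mem_image.2 ⟨(i, 1), Finset.mem_univ _, by rw [← Pi.single_smul]; rfl⟩

/-- The lattice obtained from the code by construction A, scaled to minimum `1`. -/
def lattice : Submodule ℤ (EuclideanSpace ℝ (Fin 9)) := codeLattice.map quarter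

theorem one_le_inner_of_mem {x : EuclideanSpace ℝ (Fin 9)} (hx : x ∈ lattice) (h0 : x ≠ 0) :
    1 ≤ ⟪x, x⟫ := by
  obtain ⟨y, hy, rfl⟩ := hx
  have h := sixteen_le_sum_sq hy fun h => h0 (by rw [h, map_zero])
  rw [inner_quarter, le_div_iff₀ (by norm_num)]
  exact_mod_cast h

theorem single_mem_lattice (i : Fin 9) : EuclideanSpace.single i (1 : ℝ) ∈ lattice := by
  rw [← quarter_four_smul_single]
  exact Submodule.mem_map_of_mem (mem_shortVectors_iff.1 (four_smul_single_mem_shortVectors i)).1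

theorem latticeMin_lattice : latticeMin lattice = 1 := by
  refine IsLeast.csInf_eq ⟨⟨EuclideanSpace.single 0 1, single_mem_lattice 0, by simp, by simp⟩, ?_⟩
  rintro r ⟨x, hx, h0, rfl⟩
  exact one_le_inner_of_mem hx h0

theorem minimalVectors_lattice :
    minimalVectors lattice = quarter '' (Finset.univ.biUnion shortVectors : Finset _) := by
  ext x
  simp only [minimalVectors, latticeMin_lattice, Set.mem_ofPred_eq, Set.mem_image,
    Finset.mem_coe, Finset.mem_biUnion, Finset.mem_univ, true_and, mem_shortVectors_iff]
  constructor
  · rintro ⟨⟨y, hy, rfl⟩, -, h⟩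
    rw [inner_quarter, div_eq_one_iff_eq (by norm_num)] at h
    exact ⟨y, ⟨info y, hy, rfl, by exact_mod_cast h⟩, rfl⟩
  · rintro ⟨y, ⟨p, hy, -, h⟩, rfl⟩
    have h1 : ⟪quarter y, quarter y⟫ = 1 := by rw [inner_quarter, h]; norm_num
    exact ⟨⟨y, hy, rfl⟩, fun h0 => by simp [h0] at h1, h1⟩

theorem card_minimalVectors_lattice : Nat.card (minimalVectors lattice) = 162 := by
  rw [minimalVectors_lattice, Nat.card_image_of_injective quarter_injective,
    ← card_biUnion_shortVectors]
  exact Nat.card_eq_finsetCard _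

theorem isLattice_lattice : IsLattice lattice := by
  refine ⟨DiscreteTopology.of_forall_le_dist one_pos fun x y hxy => ?_, ?_⟩
  · have h := one_le_inner_of_mem (sub_mem x.2 y.2) (sub_ne_zero.2 (Subtype.coe_injective.ne hxy))
    rw [real_inner_self_eq_norm_sq] at h
    change 1 ≤ dist x y
    rw [Subtype.dist_eq, dist_eq_norm]
    exact (one_le_sq_iff₀ (norm_nonneg _)).1 h
  · rw [eq_top_iff, ← (EuclideanSpace.basisFun (Fin 9) ℝ).toBasis.span_eq]
    refine Submodule.span_mono ?_
    rintro _ ⟨i, rfl⟩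
    simpa using single_mem_lattice i

theorem span_single_eq_map :
    Submodule.span ℤ (Set.range fun i : Fin 9 => EuclideanSpace.single i (1 : ℝ)) =
      (codeLattice ⊓ LinearMap.ker info).map quarter := by
  apply le_antisymm
  · rw [Submodule.span_le]
    rintro _ ⟨i, rfl⟩
    exact ⟨_, exists_eq_four_smul_iff.2 ⟨Pi.single i 1, rfl⟩, quarter_four_smul_single i⟩
  · rintro _ ⟨y, hy, rfl⟩
    obtain ⟨z, rfl⟩ := exists_eq_four_smul_iff.1 hy
    rw [pi_eq_sum_univ' z, Finset.smul_sum, map_sum]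
    refine Submodule.sum_mem _ fun i _ => ?_
    rw [smul_comm, map_smul]
    refine Submodule.smul_mem _ _ (Submodule.subset_span ⟨i, ?_⟩)
    simp only
    rw [← quarter_four_smul_single]

theorem lattice_eq_sup :
    lattice = (codeLattice ⊓ LinearMap.ker info).map quarter ⊔
      Submodule.span ℤ {quarter genA, quarter genB} := by
  apply le_antisymm
  · rintro _ ⟨y, hy, rfl⟩
    have hw : y - (y 0 • genA + y 8 • genB) ∈ codeLattice ⊓ LinearMap.ker info := by
      refine ⟨sub_mem hy (add_mem (codeLattice.smul_mem _ genA_mem)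
        (codeLattice.smul_mem _ genB_mem)), ?_⟩
      rw [SetLike.mem_coe, LinearMap.mem_ker, map_sub, map_add, map_smul, map_smul,
        info_genA, info_genB]
      ext <;> simp [info]
    rw [← sub_add_cancel y (y 0 • genA + y 8 • genB), map_add]
    refine Submodule.add_mem_sup (Submodule.mem_map_of_mem hw) ?_
    rw [map_add, map_smul, map_smul]
    exact Submodule.mem_span_pair.2 ⟨_, _, rfl⟩
  · refine sup_le (Submodule.map_mono inf_le_left) (Submodule.span_le.2 ?_)
    rintro _ (rfl | rfl)
    · exact Submodule.mem_map_of_mem genA_mem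
    · exact Submodule.mem_map_of_mem genB_mem

theorem nonempty_quotLat_equiv :
    Nonempty (quotLat lattice ((codeLattice ⊓ LinearMap.ker info).map quarter) ≃+
      (ZMod 4 × ZMod 4)) := by
  let E : codeLattice ≃ₗ[ℤ] lattice :=
    Submodule.equivMapOfInjective quarter quarter_injective codeLattice
  let g : lattice →ₗ[ℤ] ZMod 4 × ZMod 4 := info ∘ₗ codeLattice.subtype ∘ₗ E.symm.toLinearMap
  have hE : ∀ y : codeLattice, g (E y) = info y := fun y => by simp [g]
  have hg : Function.Surjective g := fun p => by
    obtain ⟨y, hy, hp⟩ := info_surjective_on p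
    exact ⟨E ⟨y, hy⟩, (hE _).trans hp⟩
  have hk : Submodule.comap lattice.subtype ((codeLattice ⊓ LinearMap.ker info).map quarter) =
      LinearMap.ker g := by
    ext x
    obtain ⟨y, rfl⟩ := E.surjective x
    rw [LinearMap.mem_ker, hE, Submodule.mem_comap]
    change quarter y ∈ _ ↔ _
    rw [← SetLike.mem_coe, Submodule.map_coe, quarter_injective.mem_set_image]
    simp
  exact ⟨((Submodule.quotEquivOfEq _ _ hk).trans (g.quotKerEquivOfSurjective hg)).toAddEquiv⟩

end QuaternaryCode

/-- There exists a lattice `Λ` in `ℝ⁹` possessing a Minkowskian sublattice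
`Λ'` with `Λ/Λ' ≅ (ℤ/4ℤ) × (ℤ/4ℤ)`.  Such a quotient of type `4²` occurs for
the perfect lattice `L₈₁` (with `s(L₈₁) = 81`, i.e. `|S(L₈₁)| = 162`), whose
quotient is generated over `Λ' = ℤe₁ + … + ℤe₉` by the two vectors
`(e₁+e₂+e₃+e₄+2e₅+2e₆+2e₇)/4` and `(e₂−e₃+2e₄+2e₅+e₇+2e₈+e₉)/4`. -/
theorem exists_four_four_quotient_dim_nine :
    ∃ (Λ Λ' : Submodule ℤ (EuclideanSpace ℝ (Fin 9)))
      (e : Fin 9 → EuclideanSpace ℝ (Fin 9)),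
      IsLattice Λ ∧
      LinearIndependent ℝ e ∧ (∀ i, e i ∈ minimalVectors Λ) ∧
      Λ' = Submodule.span ℤ (Set.range e) ∧
      Nat.card (minimalVectors Λ) = 2 * 81 ∧
      Λ = Λ' ⊔ Submodule.span ℤ
        ({(4 : ℝ)⁻¹ • (e 0 + e 1 + e 2 + e 3
            + (2 : ℝ) • e 4 + (2 : ℝ) • e 5 + (2 : ℝ) • e 6),
          (4 : ℝ)⁻¹ • (e 1 - e 2 + (2 : ℝ) • e 3 + (2 : ℝ) • e 4
            + e 6 + (2 : ℝ) • e 7 + e 8)} :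
          Set (EuclideanSpace ℝ (Fin 9))) ∧
      Nonempty (quotLat Λ Λ' ≃+ (ZMod 4 × ZMod 4)) := by
  open QuaternaryCode in
  refine ⟨lattice, _, fun i => EuclideanSpace.single i 1, isLattice_lattice, ?_, fun i => ?_, rfl,
    card_minimalVectors_lattice, ?_, ?_⟩
  · rw [← funext (EuclideanSpace.basisFun_apply (Fin 9) ℝ)]
    exact (EuclideanSpace.basisFun (Fin 9) ℝ).orthonormal.linearIndependent
  · rw [minimalVectors_lattice]
    exact ⟨_, Finset.mem_coe.2 (Finset.mem_biUnion.2
      ⟨0, Finset.mem_univ _, four_smul_single_mem_shortVectors i⟩), quarter_four_smul_single i⟩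
  · rw [span_single_eq_map, lattice_eq_sup]
    congr 3
    · ext i
      fin_cases i <;> simp [genA] <;> norm_num
    · congr 1
      ext i
      fin_cases i <;> simp [genB] <;> norm_num
  · rw [span_single_eq_map]
    exact nonempty_quotLat_equiv
end
end

section
/- Let L be a well-rounded lattice in ℝ⁵ with s(L) ≥ 6 that possesses a Minkowskian sublattice of index 2. Then L also possesses a Minkowskian sublattice of index 1; that is, L has a basis consisting of minimal vectors. (This is the key step showing that the universal 5-dimensional lattices are exactly those with maximal index 2 and s ≥ 6.) -/
open scoped BigOperators RealInnerProductSpace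

noncomputable section

section SignedSums

variable {V : Type*} [NormedAddCommGroup V] [InnerProductSpace ℝ V] {ι : Type*}

/-- Signs can be chosen so that the norm of a signed sum is at most the sum of the norms. -/
lemma exists_signs_inner_le (v : V) (f : ι → V) (S : Finset ι) :
    ∃ s : ι → ℤ, (∀ i, s i = 1 ∨ s i = -1) ∧
      ⟪v + ∑ i ∈ S, s i • f i, v + ∑ i ∈ S, s i • f i⟫ ≤ ⟪v, v⟫ + ∑ i ∈ S, ⟪f i, f i⟫ := by
  classical
  induction S using Finset.induction_on with
  | empty => exact ⟨fun _ => 1, fun _ => Or.inl rfl, by simp⟩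
  | insert a S ha ih =>
    obtain ⟨s, hs, hle⟩ := ih
    set w := v + ∑ i ∈ S, s i • f i with hw
    obtain ⟨t, ht, htle⟩ : ∃ t : ℤ, (t = 1 ∨ t = -1) ∧
        ⟪w + t • f a, w + t • f a⟫ ≤ ⟪w, w⟫ + ⟪f a, f a⟫ := by
      rcases le_total ⟪w, f a⟫ 0 with h | h
      · refine ⟨1, Or.inl rfl, ?_⟩
        rw [one_smul, real_inner_add_add_self]
        linarith
      · refine ⟨-1, Or.inr rfl, ?_⟩
        rw [neg_one_smul, ← sub_eq_add_neg, real_inner_sub_sub_self]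
        linarith
    refine ⟨Function.update s a t, fun i => ?_, ?_⟩
    · by_cases h : i = a
      · subst h; simpa using ht
      · simpa [h] using hs i
    · have hsum : ∑ i ∈ S, Function.update s a t i • f i = ∑ i ∈ S, s i • f i :=
        Finset.sum_congr rfl fun i hi => by
          rw [Function.update_of_ne (ne_of_mem_of_not_mem hi ha)]
      have hv : v + ∑ i ∈ insert a S, Function.update s a t i • f i = w + t • f a := by
        rw [Finset.sum_insert ha, hsum, Function.update_self, hw]; abel
      rw [hv, Finset.sum_insert ha]
      linarith

/-- If half of `v + ∑ f i` lies in a lattice, then so does half of some signed sum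
`v + ∑ ± f i`, of norm at most a quarter of the sum of the norms. -/
lemma exists_signed_half {L : Submodule ℤ V} {u v : V} {f : ι → V} {S : Finset ι} (hu : u ∈ L)
    (hf : ∀ i, f i ∈ L) (h : u + u = v + ∑ i ∈ S, f i) :
    ∃ s : ι → ℤ, (∀ i, s i = 1 ∨ s i = -1) ∧ ∃ u' ∈ L, u' + u' = v + ∑ i ∈ S, s i • f i ∧
      4 * ⟪u', u'⟫ ≤ ⟪v, v⟫ + ∑ i ∈ S, ⟪f i, f i⟫ := by
  obtain ⟨s, hs, hle⟩ := exists_signs_inner_le v f S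
  have hd : u + ∑ i ∈ S, ((s i - 1) / 2) • f i + (u + ∑ i ∈ S, ((s i - 1) / 2) • f i) =
      v + ∑ i ∈ S, s i • f i := by
    have : ∑ i ∈ S, s i • f i = ∑ i ∈ S, (f i + ((s i - 1) / 2) • f i + ((s i - 1) / 2) • f i) :=
      Finset.sum_congr rfl fun i _ => by
        rcases hs i with h | h <;> norm_num [h]
    rw [this, Finset.sum_add_distrib, Finset.sum_add_distrib, add_add_add_comm, h]
    abel
  refine ⟨s, hs, _, L.add_mem hu (L.sum_mem fun i _ => L.smul_mem _ (hf i)), hd, ?_⟩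
  rw [← hd, real_inner_add_add_self] at hle
  linarith

/-- If moreover the sum of the norms is less than four times the minimum, then some signed sum
vanishes. -/
lemma exists_signed_sum_eq_zero {L : Submodule ℤ V} {m : ℝ} (hm : ∀ v ∈ L, v ≠ 0 → m ≤ ⟪v, v⟫)
    {u v : V} {f : ι → V} {S : Finset ι} (hu : u ∈ L)
    (hf : ∀ i, f i ∈ L) (h : u + u = v + ∑ i ∈ S, f i)
    (hlt : ⟪v, v⟫ + ∑ i ∈ S, ⟪f i, f i⟫ < 4 * m) :
    ∃ s : ι → ℤ, (∀ i, s i = 1 ∨ s i = -1) ∧ v + ∑ i ∈ S, s i • f i = 0 := by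
  obtain ⟨s, hs, u', hu', hd, hle⟩ := exists_signed_half hu hf h
  refine ⟨s, hs, ?_⟩
  by_contra hne
  have h0 : u' ≠ 0 := by rintro rfl; simp at hd; exact hne hd.symm
  linarith [hm u' hu' h0]

end SignedSums

section FiveFrame

variable {V : Type*} [NormedAddCommGroup V] [InnerProductSpace ℝ V]

/-- The lattice `L` contains a vector of norm `m`, twice which is an integral combination of `e`
having some coefficient `±1`. -/
def HasUnitHalfVector (L : Submodule ℤ V) (m : ℝ) (e : Fin 5 → V) : Prop :=
  ∃ z ∈ L, ⟪z, z⟫ = m ∧ ∃ a : Fin 5 → ℤ, z + z = ∑ i, a i • e i ∧ ∃ i, a i = 1 ∨ a i = -1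

variable {L : Submodule ℤ V} {m : ℝ} {e : Fin 5 → V}

omit [InnerProductSpace ℝ V] in
lemma sum_smul_eq_univ (S : Finset (Fin 5)) (s : Fin 5 → ℤ) :
    ∑ i ∈ S, s i • e i = ∑ i, (if i ∈ S then s i else 0) • e i := by
  simp [ite_smul, Finset.sum_ite_mem]

lemma hasUnitHalfVector_of_inner_le (hm : ∀ v ∈ L, v ≠ 0 → m ≤ ⟪v, v⟫)
    (he : LinearIndependent ℤ e) {u : V} (hu : u ∈ L) (hle : ⟪u, u⟫ ≤ m) {a : Fin 5 → ℤ}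
    (h : u + u = ∑ i, a i • e i) {i : Fin 5} (hi : a i = 1 ∨ a i = -1) :
    HasUnitHalfVector L m e := by
  refine ⟨u, hu, le_antisymm hle (hm u hu ?_), a, h, i, hi⟩
  rintro rfl
  have := Fintype.linearIndependent_iff.1 he a (by rw [← h]; simp) i
  omega

/-- A half-sum of a proper nonempty part of the frame forces a unit half vector. -/
lemma hasUnitHalfVector_of_card_le_four (hm : ∀ v ∈ L, v ≠ 0 → m ≤ ⟪v, v⟫)
    (he : LinearIndependent ℤ e) (heL : ∀ i, e i ∈ L) (hem : ∀ i, ⟪e i, e i⟫ = m) (hm0 : 0 < m)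
    {w : V} (hw : w ∈ L) {S : Finset (Fin 5)} (hS : S.Nonempty) (hc : S.card ≤ 4)
    (h : w + w = ∑ i ∈ S, e i) : HasUnitHalfVector L m e := by
  obtain ⟨s, hs, u, hu, hd, hle⟩ :=
    exists_signed_half (v := 0) hw heL (by rw [h, zero_add])
  obtain ⟨j, hj⟩ := hS
  rw [zero_add, sum_smul_eq_univ] at hd
  refine hasUnitHalfVector_of_inner_le hm he hu ?_ hd (i := j) (by simpa [hj] using hs j)
  have hc' : (S.card : ℝ) ≤ 4 := by exact_mod_cast hc
  simp only [hem, Finset.sum_const, nsmul_eq_mul, inner_zero_left, zero_add] at hle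
  nlinarith

/-- A vector of norm `m` congruent modulo `2L` to a sum of at most two frame vectors, and different
from all `± e i`, yields a unit half vector. -/
lemma hasUnitHalfVector_of_card_le_two (hm : ∀ v ∈ L, v ≠ 0 → m ≤ ⟪v, v⟫)
    (he : LinearIndependent ℤ e) (heL : ∀ i, e i ∈ L) (hem : ∀ i, ⟪e i, e i⟫ = m) (hm0 : 0 < m)
    {w : V} (hw : w ∈ L) (hwe : w + w = ∑ i, e i)
    {y : V} (hym : ⟪y, y⟫ = m) (hye : ∀ i, y ≠ e i ∧ y ≠ -e i)
    {K : Finset (Fin 5)} (hK : K.card ≤ 2) {u : V} (hu : u ∈ L) (h : u + u = y + ∑ i ∈ K, e i) :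
    HasUnitHalfVector L m e := by
  have hK' : (K.card : ℝ) ≤ 2 := by exact_mod_cast hK
  obtain ⟨s, hs, hz⟩ := exists_signed_sum_eq_zero hm hu heL h (by
    simp only [hem, hym, Finset.sum_const, nsmul_eq_mul]; nlinarith)
  have hcard : K.card = 2 := by
    by_contra hne
    have hlt : K.card = 0 ∨ K.card = 1 := by omega
    rcases hlt with h0 | h1
    · rw [Finset.card_eq_zero.1 h0, Finset.sum_empty, add_zero] at hz
      rw [hz, inner_zero_left] at hym
      linarith
    · obtain ⟨i, rfl⟩ := Finset.card_eq_one.1 h1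
      rw [Finset.sum_singleton] at hz
      rcases hs i with h | h
      · exact (hye i).2 (eq_neg_of_add_eq_zero_left (by simpa [h] using hz))
      · exact (hye i).1 (sub_eq_zero.1 (by simpa [h, sub_eq_add_neg] using hz))
  have hcompl : Kᶜ.card = 3 := by rw [Finset.card_compl, hcard]; rfl
  have hsplit : ∑ i ∈ K, e i + ∑ i ∈ Kᶜ, e i = ∑ i, e i := Finset.sum_add_sum_compl K e
  have hu2 : (u - ∑ i ∈ K, e i + w) + (u - ∑ i ∈ K, e i + w) = y + ∑ i ∈ Kᶜ, e i := by
    calc _ = (u + u) + (w + w) - ∑ i ∈ K, e i - ∑ i ∈ K, e i := by abel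
      _ = _ := by rw [h, hwe, ← hsplit]; abel
  have hu2L : u - ∑ i ∈ K, e i + w ∈ L :=
    L.add_mem (L.sub_mem hu (L.sum_mem fun i _ => heL i)) hw
  obtain ⟨t, ht, u', hu', hd, hle⟩ := exists_signed_half hu2L heL hu2
  obtain ⟨j, hj⟩ : Kᶜ.Nonempty := Finset.card_pos.1 (by omega)
  have hy : y = ∑ i, (if i ∈ K then -s i else 0) • e i := by
    rw [← sum_smul_eq_univ, eq_neg_of_add_eq_zero_left hz]
    simp
  rw [hy, sum_smul_eq_univ Kᶜ, ← Finset.sum_add_distrib] at hd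
  simp only [← add_smul] at hd
  refine hasUnitHalfVector_of_inner_le hm he hu' ?_ hd (i := j) ?_
  · simp only [hem, hym, Finset.sum_const, nsmul_eq_mul, hcompl] at hle
    push_cast at hle
    linarith
  · have hj' : j ∉ K := Finset.mem_compl.1 hj
    simpa [hj'] using ht j

/-- A vector of norm `m` in the span of the frame, different from all `± e i`, yields a unit half
vector. -/
lemma hasUnitHalfVector_of_eq_sum (hm : ∀ v ∈ L, v ≠ 0 → m ≤ ⟪v, v⟫)
    (he : LinearIndependent ℤ e) (heL : ∀ i, e i ∈ L) (hem : ∀ i, ⟪e i, e i⟫ = m) (hm0 : 0 < m)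
    {w : V} (hw : w ∈ L) (hwe : w + w = ∑ i, e i)
    {y : V} (hym : ⟪y, y⟫ = m) (hye : ∀ i, y ≠ e i ∧ y ≠ -e i)
    {a : Fin 5 → ℤ} (hya : y = ∑ i, a i • e i) : HasUnitHalfVector L m e := by
  classical
  set J : Finset (Fin 5) := {i | a i % 2 = 1} with hJ
  set q : V := ∑ i, (a i / 2) • e i with hq
  have hqL : q ∈ L := L.sum_mem fun i _ => L.smul_mem _ (heL i)
  have hJsum : ∑ i ∈ J, e i = ∑ i, (a i % 2) • e i := by
    rw [hJ, Finset.sum_filter]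
    refine Finset.sum_congr rfl fun i _ => ?_
    rcases Int.emod_two_eq_zero_or_one (a i) with h | h <;> simp [h]
  have hy : y = q + q + ∑ i ∈ J, e i := by
    rw [hJsum, hq, hya, ← Finset.sum_add_distrib, ← Finset.sum_add_distrib]
    refine Finset.sum_congr rfl fun i _ => ?_
    rw [← add_smul, ← add_smul]
    congr 1
    omega
  rcases le_or_gt J.card 2 with hc | hc
  · refine hasUnitHalfVector_of_card_le_two hm he heL hem hm0 hw hwe hym hye hc
      (u := q + ∑ i ∈ J, e i) (L.add_mem hqL (L.sum_mem fun i _ => heL i)) ?_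
    rw [hy]; abel
  · refine hasUnitHalfVector_of_card_le_two hm he heL hem hm0 hw hwe hym hye (K := Jᶜ)
      (u := q + w) (by rw [Finset.card_compl, Fintype.card_fin]; omega) (L.add_mem hqL hw) ?_
    calc q + w + (q + w) = q + q + (w + w) := by abel
      _ = _ := by rw [hwe, hy, add_assoc _ (∑ i ∈ J, e i), Finset.sum_add_sum_compl J e]

/-- Half the sum of five vectors of norm `m` with pairwise inner products at most `m / 2` comes
close to one of them. -/
lemma exists_inner_sub_le {f : Fin 5 → V} (hfm : ∀ i, ⟪f i, f i⟫ = m)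
    (hff : ∀ i j, i ≠ j → ⟪f i, f j⟫ ≤ m / 2) {x : V} (hx : x + x = ∑ i, f i) :
    ∃ i, ⟪x - f i, x - f i⟫ ≤ 7 / 4 * m := by
  have hsum : ∑ i, ⟪x, f i⟫ = 2 * ⟪x, x⟫ := by
    rw [← inner_sum, ← hx, inner_add_right]; ring
  have hrow : ∀ i, 2 * ⟪x, f i⟫ ≤ 3 * m := fun i => by
    have h1 : 2 * ⟪x, f i⟫ = ∑ j, ⟪f j, f i⟫ := by
      rw [← sum_inner, ← hx, inner_add_left]; ring
    have h2 : ∑ j ∈ Finset.univ.erase i, ⟪f j, f i⟫ ≤ ∑ j ∈ Finset.univ.erase i, m / 2 :=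
      Finset.sum_le_sum fun j hj => hff j i (Finset.ne_of_mem_erase hj)
    rw [h1, ← Finset.add_sum_erase _ _ (Finset.mem_univ i), hfm]
    rw [Finset.sum_const, Finset.card_erase_of_mem (Finset.mem_univ i), Finset.card_univ,
      Fintype.card_fin, nsmul_eq_mul] at h2
    push_cast at h2
    linarith
  have htot : ∑ i, ⟪x - f i, x - f i⟫ ≤ ∑ _i : Fin 5, 7 / 4 * m := by
    have hexp : ∀ i, ⟪x - f i, x - f i⟫ = ⟪x, x⟫ - 2 * ⟪x, f i⟫ + m := fun i => by
      rw [real_inner_sub_sub_self, hfm]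
    simp only [hexp, Fin.sum_univ_five] at hsum ⊢
    linarith [hrow 0, hrow 1, hrow 2, hrow 3, hrow 4]
  obtain ⟨i, -, hi⟩ := Finset.exists_le_of_sum_le Finset.univ_nonempty htot
  exact ⟨i, hi⟩

/-- A vector of norm `m` in the nontrivial coset of the frame yields a unit half vector. -/
lemma hasUnitHalfVector_of_eq_half_add_sum (hm : ∀ v ∈ L, v ≠ 0 → m ≤ ⟪v, v⟫)
    (he : LinearIndependent ℤ e) (heL : ∀ i, e i ∈ L) (hem : ∀ i, ⟪e i, e i⟫ = m) (hm0 : 0 < m)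
    {w : V} (hw : w ∈ L) (hwe : w + w = ∑ i, e i)
    {y : V} (hyL : y ∈ L) (hym : ⟪y, y⟫ = m)
    {c : Fin 5 → ℤ} (hyc : y = w + ∑ i, c i • e i) : HasUnitHalfVector L m e := by
  obtain ⟨σ, hσ⟩ : ∃ σ : Fin 5 → ℤ, ∀ i, σ i = 1 - 2 * (c i % 2) := ⟨_, fun _ => rfl⟩
  have hσ' : ∀ i, σ i = 1 ∨ σ i = -1 := fun i => by have := hσ i; omega
  obtain ⟨f, hf⟩ : ∃ f : Fin 5 → V, ∀ i, f i = σ i • e i := ⟨_, fun _ => rfl⟩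
  have hfL : ∀ i, f i ∈ L := fun i => hf i ▸ L.smul_mem _ (heL i)
  have hfm : ∀ i, ⟪f i, f i⟫ = m := fun i => by
    rw [hf, ← hem i]; rcases hσ' i with h | h <;> simp [h]
  have hff : ∀ i j, i ≠ j → ⟪f i, f j⟫ ≤ m / 2 := fun i j hij => by
    have hne : f i - f j ≠ 0 := fun h0 => by
      have h1 := Fintype.linearIndependent_iff.1 he (Pi.single i (σ i) - Pi.single j (σ j)) (by
        simpa [sub_smul, Finset.sum_sub_distrib, Pi.single_apply, ite_smul, hf] using h0) i
      simp [hij] at h1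
      have := hσ' i
      omega
    have := hm _ (L.sub_mem (hfL i) (hfL j)) hne
    rw [real_inner_sub_sub_self, hfm, hfm] at this
    linarith
  obtain ⟨q, hq⟩ : ∃ q : V, q = ∑ i, (c i / 2) • e i := ⟨_, rfl⟩
  obtain ⟨r, hr⟩ : ∃ r : V, r = ∑ i, (c i % 2) • e i := ⟨_, rfl⟩
  have hqL : q ∈ L := hq ▸ L.sum_mem fun i _ => L.smul_mem _ (heL i)
  have hrL : r ∈ L := hr ▸ L.sum_mem fun i _ => L.smul_mem _ (heL i)
  have hxf : (w - r) + (w - r) = ∑ i, f i := by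
    calc (w - r) + (w - r) = w + w - r - r := by abel
      _ = _ := by
        rw [hwe, hr, ← Finset.sum_sub_distrib, ← Finset.sum_sub_distrib]
        refine Finset.sum_congr rfl fun i _ => ?_
        rw [hf, hσ]
        module
  have hy : y = (w - r) + r + r + q + q := by
    have hc : ∑ i, c i • e i = r + q + q := by
      rw [hr, hq, ← Finset.sum_add_distrib, ← Finset.sum_add_distrib]
      refine Finset.sum_congr rfl fun i _ => ?_
      rw [← add_smul, ← add_smul]
      congr 1
      omega
    rw [hyc, hc]
    abel
  obtain ⟨x, hx⟩ : ∃ x, x = w - r := ⟨_, rfl⟩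
  rw [← hx] at hxf hy
  have hxL : x ∈ L := hx ▸ L.sub_mem hw hrL
  obtain ⟨i, hi⟩ := exists_inner_sub_le hfm hff hxf
  obtain ⟨s, hs, hz⟩ := exists_signed_sum_eq_zero hm (u := x + r + q) (v := y)
    (f := ![x - f i, f i]) (S := Finset.univ) (L.add_mem (L.add_mem hxL hrL) hqL)
    (by
      intro k
      fin_cases k
      · exact L.sub_mem hxL (hfL i)
      · exact hfL i)
    (by
      simp only [Fin.sum_univ_two, Matrix.cons_val_zero, Matrix.cons_val_one, hy]
      abel)
    (by
      simp only [Fin.sum_univ_two, Matrix.cons_val_zero, Matrix.cons_val_one, hym, hfm]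
      linarith)
  simp only [Fin.sum_univ_two, Matrix.cons_val_zero, Matrix.cons_val_one] at hz
  have hyy : y + y = ∑ j, (-s 0 * σ j + if j = i then (2 * s 0 - 2 * s 1) * σ i else 0) • e j := by
    have h1 : y + y = (-s 0) • (x + x) + (2 * s 0 - 2 * s 1) • f i := by
      rw [eq_neg_of_add_eq_zero_left hz]
      module
    have h2 : ∑ j, (if j = i then (2 * s 0 - 2 * s 1) * σ i else 0) • e j =
        (2 * s 0 - 2 * s 1) • f i := by
      simp [ite_smul, hf, mul_smul]
    simp only [add_smul, Finset.sum_add_distrib]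
    rw [h1, h2, hxf, Finset.smul_sum]
    simp only [mul_smul, hf]
  obtain ⟨j, hj⟩ := exists_ne i
  refine ⟨y, hyL, hym, _, hyy, j, ?_⟩
  rw [if_neg hj]
  rcases hs 0 with h | h <;> rcases hσ' j with h' | h' <;> simp [h, h']

end FiveFrame

lemma latticeMin_le_s19 {n : ℕ} {L : Submodule ℤ (EuclideanSpace ℝ (Fin n))}
    {v : EuclideanSpace ℝ (Fin n)} (hv : v ∈ L) (h0 : v ≠ 0) : latticeMin L ≤ ⟪v, v⟫ :=
  csInf_le ⟨0, by rintro r ⟨x, -, -, rfl⟩; exact real_inner_self_nonneg⟩ ⟨v, hv, h0, rfl⟩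

/-- In a lattice of index two over the span of a frame, differences of vectors outside the span
lie in the span. -/
lemma sub_mem_of_subIndex_eq_two {n : ℕ} {L M : Submodule ℤ (EuclideanSpace ℝ (Fin n))}
    (h : subIndex L M = 2) {u v : EuclideanSpace ℝ (Fin n)} (hu : u ∈ L) (hv : v ∈ L)
    (huM : u ∉ M) (hvM : v ∉ M) : u - v ∈ M := by
  have hidx : (Submodule.comap L.subtype M).toAddSubgroup.index = 2 := h
  have := (AddSubgroup.add_mem_iff_of_index_two hidx (a := ⟨u, hu⟩) (b := -⟨v, hv⟩)).2
    (by simp [huM, hvM])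
  simpa [sub_eq_add_neg] using this

lemma exists_notMem_of_subIndex_eq_two {n : ℕ} {L M : Submodule ℤ (EuclideanSpace ℝ (Fin n))}
    (h : subIndex L M = 2) : ∃ w ∈ L, w ∉ M := by
  by_contra! hcon
  have htop : Submodule.comap L.subtype M = ⊤ := by
    ext ⟨x, hx⟩; simp [hcon x hx]
  have hsub : Subsingleton (quotLat L M) := Submodule.Quotient.subsingleton_iff.2 htop
  have : subIndex L M = 1 := Nat.card_unique
  omega

/-- Exchanging a frame vector for a half vector with coefficient `±1` yields a basis. -/
lemma exists_minkowskian_of_hasUnitHalfVector {L : Submodule ℤ (EuclideanSpace ℝ (Fin 5))}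
    {e : Fin 5 → EuclideanSpace ℝ (Fin 5)} (he : LinearIndependent ℝ e)
    (hmin : ∀ i, e i ∈ minimalVectors L)
    (h2 : subIndex L (Submodule.span ℤ (Set.range e)) = 2)
    (h : HasUnitHalfVector L (latticeMin L) e) :
    ∃ Λ : Submodule ℤ (EuclideanSpace ℝ (Fin 5)), IsMinkowskian L Λ ∧ subIndex L Λ = 1 := by
  obtain ⟨z, hz, hzm, a, hza, i, hi⟩ := h
  have heZ : LinearIndependent ℤ e := he.restrict_scalars' ℤ
  have hz0 : z ≠ 0 := by
    rintro rfl
    have := Fintype.linearIndependent_iff.1 heZ a (by rw [← hza]; simp) i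
    omega
  have hzM : z ∉ Submodule.span ℤ (Set.range e) := fun hmem => by
    obtain ⟨c, hc⟩ := (Submodule.mem_span_range_iff_exists_fun ℤ).1 hmem
    have := Fintype.linearIndependent_iff.1 heZ (fun j => a j - (c j + c j)) (by
      simp only [sub_smul, add_smul, Finset.sum_sub_distrib, Finset.sum_add_distrib, hc, ← hza,
        sub_self]) i
    omega
  obtain ⟨g, hg⟩ : ∃ g, g = Function.update e i z := ⟨_, rfl⟩
  have hgi : g i = z := by simp [hg]
  have hgj : ∀ j, j ≠ i → g j = e j := fun j hj => by simp [hg, hj]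
  have hgmin : ∀ j, g j ∈ minimalVectors L := fun j => by
    by_cases hj : j = i
    · rw [hj, hgi]; exact ⟨hz, hz0, hzm⟩
    · rw [hgj j hj]; exact hmin j
  have hgmem : ∀ j, g j ∈ Submodule.span ℤ (Set.range g) := fun j =>
    Submodule.subset_span ⟨j, rfl⟩
  have hemem : ∀ j, e j ∈ Submodule.span ℤ (Set.range g) := by
    have hne : ∀ j, j ≠ i → e j ∈ Submodule.span ℤ (Set.range g) := fun j hj =>
      hgj j hj ▸ hgmem j
    intro j
    by_cases hj : j = i
    · subst hj
      have hsplit : a j • e j = z + z - ∑ k ∈ Finset.univ.erase j, a k • e k := by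
        rw [hza, ← Finset.add_sum_erase _ _ (Finset.mem_univ j)]; abel
      have hmem : a j • e j ∈ Submodule.span ℤ (Set.range g) := by
        rw [hsplit]
        exact Submodule.sub_mem _ (Submodule.add_mem _ (hgi ▸ hgmem j) (hgi ▸ hgmem j))
          (Submodule.sum_mem _ fun k hk =>
            Submodule.smul_mem _ _ (hne k (Finset.ne_of_mem_erase hk)))
      rcases hi with h | h
      · simpa [h] using hmem
      · simpa [h] using hmem
    · exact hne j hj
  have hMle : Submodule.span ℤ (Set.range e) ≤ Submodule.span ℤ (Set.range g) :=
    Submodule.span_le.2 (by rintro _ ⟨j, rfl⟩; exact hemem j)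
  have hLle : L ≤ Submodule.span ℤ (Set.range g) := fun v hv => by
    by_cases hvM : v ∈ Submodule.span ℤ (Set.range e)
    · exact hMle hvM
    · rw [← sub_add_cancel v z]
      exact Submodule.add_mem _ (hMle (sub_mem_of_subIndex_eq_two h2 hv hz hvM hzM))
        (hgi ▸ hgmem i)
  have hetop : Submodule.span ℝ (Set.range e) = ⊤ :=
    he.span_eq_top_of_card_eq_finrank (by simp)
  have hgLI : LinearIndependent ℝ g := by
    refine linearIndependent_of_top_le_span_of_card_eq_finrank ?_ (by simp)
    rw [← hetop, Submodule.span_le]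
    rintro _ ⟨j, rfl⟩
    exact Submodule.span_subset_span ℤ ℝ _ (hemem j)
  refine ⟨_, ⟨g, hgLI, hgmin, rfl⟩, ?_⟩
  have hsub : Subsingleton (quotLat L (Submodule.span ℤ (Set.range g))) :=
    Submodule.Quotient.subsingleton_iff.2 (Submodule.comap_subtype_eq_top.2 hLle)
  exact Nat.card_unique

/-- The double of a vector outside a sublattice of index two lies in the sublattice. -/
lemma add_self_mem_of_subIndex_eq_two {n : ℕ} {L M : Submodule ℤ (EuclideanSpace ℝ (Fin n))}
    (h : subIndex L M = 2) {w : EuclideanSpace ℝ (Fin n)} (hw : w ∈ L) : w + w ∈ M := by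
  by_cases hwM : w ∈ M
  · exact M.add_mem hwM hwM
  · simpa using sub_mem_of_subIndex_eq_two h hw (L.neg_mem hw) hwM (by simpa using hwM)

/-- A set with at least twelve elements contains a vector other than `± e i`, `i : Fin 5`. -/
lemma exists_mem_ne_of_twelve_le_card {V : Type*} [AddGroup V] {s : Set V}
    (hs : 12 ≤ Nat.card s) (e : Fin 5 → V) : ∃ y ∈ s, ∀ i, y ≠ e i ∧ y ≠ -e i := by
  classical
  by_contra! hcon
  let T : Finset V := Finset.univ.image e ∪ Finset.univ.image fun i => -e i
  have hT : T.card ≤ 10 := (Finset.card_union_le _ _).trans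
    (Nat.add_le_add Finset.card_image_le Finset.card_image_le)
  have hsT : s ⊆ T := fun y hy => by
    obtain ⟨i, hi⟩ := hcon y hy
    by_cases h : y = e i
    · simp [T, h]
    · simp [T, hi h]
  have := Nat.card_mono T.finite_toSet hsT
  simp only [Nat.card_eq_card_toFinset, Finset.toFinset_coe] at this hs
  omega

/-- Let `L` be a well-rounded lattice in `ℝ⁵` with `s(L) ≥ 6`
(i.e. `|S(L)| ≥ 12`) possessing a Minkowskian sublattice of index `2`.  Then
`L` also possesses a Minkowskian sublattice of index `1`; that is, `L` has a
basis consisting of minimal vectors. -/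
theorem dim_five_index_two_has_minimal_basis
    (L : Submodule ℤ (EuclideanSpace ℝ (Fin 5))) (hL : IsLattice L)
    (hwr : Submodule.span ℝ (minimalVectors L) = ⊤)
    (hs : 12 ≤ Nat.card (minimalVectors L))
    (h2 : ∃ Λ' : Submodule ℤ (EuclideanSpace ℝ (Fin 5)),
      IsMinkowskian L Λ' ∧ subIndex L Λ' = 2) :
    ∃ Λ'' : Submodule ℤ (EuclideanSpace ℝ (Fin 5)),
      IsMinkowskian L Λ'' ∧ subIndex L Λ'' = 1 := by
  obtain ⟨M, ⟨e, he, hmin, rfl⟩, hidx⟩ := h2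
  refine exists_minkowskian_of_hasUnitHalfVector he hmin hidx ?_
  have heZ : LinearIndependent ℤ e := he.restrict_scalars' ℤ
  have heL : ∀ i, e i ∈ L := fun i => (hmin i).1
  have hem : ∀ i, ⟪e i, e i⟫ = latticeMin L := fun i => (hmin i).2.2
  have hm : ∀ v ∈ L, v ≠ 0 → latticeMin L ≤ ⟪v, v⟫ := fun v => latticeMin_le_s19
  have hm0 : 0 < latticeMin L := hem 0 ▸ real_inner_self_pos.2 (hmin 0).2.1
  obtain ⟨v, hv, hvM⟩ := exists_notMem_of_subIndex_eq_two hidx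
  obtain ⟨b, hb⟩ := (Submodule.mem_span_range_iff_exists_fun ℤ).1
    (add_self_mem_of_subIndex_eq_two hidx hv)
  set S : Finset (Fin 5) := {i | b i % 2 = 1} with hS
  obtain ⟨q, hq⟩ : ∃ q, q = ∑ i, (b i / 2) • e i := ⟨_, rfl⟩
  have hqM : q ∈ Submodule.span ℤ (Set.range e) := hq ▸ Submodule.sum_mem _ fun i _ =>
    Submodule.smul_mem _ _ (Submodule.subset_span ⟨i, rfl⟩)
  have hqL : q ∈ L := hq ▸ L.sum_mem fun i _ => L.smul_mem _ (heL i)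
  have hw : v - q ∈ L := L.sub_mem hv hqL
  have hwM : v - q ∉ Submodule.span ℤ (Set.range e) := fun h =>
    hvM (by simpa using Submodule.add_mem _ h hqM)
  have hwS : (v - q) + (v - q) = ∑ i ∈ S, e i := by
    calc (v - q) + (v - q) = (v + v) - q - q := by abel
      _ = ∑ i, (b i % 2) • e i := by
        rw [← hb, hq, ← Finset.sum_sub_distrib, ← Finset.sum_sub_distrib]
        refine Finset.sum_congr rfl fun i _ => ?_
        rw [← sub_smul, ← sub_smul]
        congr 1
        omega
      _ = _ := by
        rw [hS, Finset.sum_filter]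
        refine Finset.sum_congr rfl fun i _ => ?_
        rcases Int.emod_two_eq_zero_or_one (b i) with h | h <;> simp [h]
  have hSne : S.Nonempty := by
    rw [Finset.nonempty_iff_ne_empty]
    intro h0
    rw [h0, Finset.sum_empty, ← two_smul ℝ, smul_eq_zero_iff_right two_ne_zero] at hwS
    exact hwM (hwS ▸ Submodule.zero_mem _)
  rcases le_or_gt S.card 4 with hc | hc
  · exact hasUnitHalfVector_of_card_le_four hm heZ heL hem hm0 hw hSne hc hwS
  have hSuniv : S = Finset.univ := by
    rw [← Finset.card_eq_iff_eq_univ, Fintype.card_fin]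
    have := Finset.card_le_univ S
    rw [Fintype.card_fin] at this
    omega
  rw [hSuniv] at hwS
  obtain ⟨y, ⟨hyL, -, hym⟩, hye⟩ := exists_mem_ne_of_twelve_le_card hs e
  by_cases hyM : y ∈ Submodule.span ℤ (Set.range e)
  · obtain ⟨a, ha⟩ := (Submodule.mem_span_range_iff_exists_fun ℤ).1 hyM
    exact hasUnitHalfVector_of_eq_sum hm heZ heL hem hm0 hw hwS hym hye ha.symm
  · obtain ⟨c, hc⟩ := (Submodule.mem_span_range_iff_exists_fun ℤ).1
      (sub_mem_of_subIndex_eq_two hidx hyL hw hyM hwM)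
    exact hasUnitHalfVector_of_eq_half_add_sum hm heZ heL hem hm0 hw hwS hyL hym (c := c)
      (by rw [hc]; abel)
end
end
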